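/- arXiv:2506.00852 — 3 statements merged into one kernel-verified Lean document; each statement's English description precedes it below -/
import Mathlib

section
/- Let Q be a probability measure on [a,b] with a < b, K a positive integer, and f a continuous, monotone, convex-or-concave function on [a,b] with variation V = |f(b) − f(a)|. Set δ_min = min(|f'_r(a)|, |f'_l(b)|) and δ_max = max(|f'_r(a)|, |f'_l(b)|) ∈ [0,∞]. Suppose Q has a modulus w such that Ψ(x) = ∫_0^x (w(t) − w(0))/t dt < ∞ for every x > 0. Then for every δ ∈ [δ_min, δ_max] ∩ (0,∞) there exists a 2K-linear interpolation f̄ of f on [a,b] such that ∫_{[a,b]} |f − f̄| dQ ≤ V·w(0) + (δ − δ_min)·(b−a)/(4K²) + (V/K)·[ Ψ(V/(2Kδ)) − Ψ(V/(2K·δ_max)) ]. -/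
open MeasureTheory Filter
open scoped ENNReal

/-- `l` is a `K`-linear interpolation of `f` on `[a,b]`. -/
def IsLinearInterp (f : ℝ → ℝ) (a b : ℝ) (K : ℕ) (l : ℝ → ℝ) : Prop :=
  ∃ t : Fin (K + 1) → ℝ, t 0 = a ∧ t (Fin.last K) = b ∧ StrictMono t ∧
    ∀ i : Fin K, ∀ y ∈ Set.Icc (t i.castSucc) (t i.succ),
      l y = f (t i.castSucc) +
        (f (t i.succ) - f (t i.castSucc)) / (t i.succ - t i.castSucc) * (y - t i.castSucc)

/-- `w` is a modulus of the Borel measure `μ` on `ℝ`. -/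
def IsModulus (μ : Measure ℝ) (w : ℝ → ℝ) : Prop :=
  (∀ u, 0 ≤ u → 0 ≤ w u) ∧ MonotoneOn w (Set.Ici 0) ∧ ConcaveOn ℝ (Set.Ici 0) w ∧
  ∀ I : Set ℝ, I.OrdConnected → Bornology.IsBounded I →
    μ I ≤ ENNReal.ofReal (w (volume I).toReal)

/-- `Ψ(x) = ∫₀ˣ (w(t) − w(0))/t dt`. -/
noncomputable def Psi (w : ℝ → ℝ) (x : ℝ) : ℝ :=
  ∫ t in Set.Ioc 0 x, (w t - w 0) / t

/-- A chord of a convex function lies above the function. -/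
lemma ConvexOn.le_chord {f : ℝ → ℝ} {s : Set ℝ} (hf : ConvexOn ℝ s f) {p q y : ℝ}
    (hp : p ∈ s) (hq : q ∈ s) (hpy : p ≤ y) (hyq : y ≤ q) :
    f y ≤ f p + (f q - f p) / (q - p) * (y - p) := by
  rcases (hpy.trans hyq).eq_or_lt with h | h
  · obtain rfl : y = p := le_antisymm (h ▸ hyq) hpy
    simp
  · have hd : 0 < q - p := sub_pos.2 h
    have key := hf.2 hp hq
      (div_nonneg (by linarith) hd.le : 0 ≤ (q - y) / (q - p))
      (div_nonneg (by linarith) hd.le : 0 ≤ (y - p) / (q - p)) (by field_simp; ring)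
    have e : ((q - y) / (q - p)) • p + ((y - p) / (q - p)) • q = y := by
      simp only [smul_eq_mul]; field_simp; ring
    rw [e] at key
    refine key.trans (le_of_eq ?_)
    simp only [smul_eq_mul]; field_simp; ring

/-- A quadratically perturbed support line of a convex function is a support line. -/
lemma ConvexOn.support_of_quadratic {f : ℝ → ℝ} {s : Set ℝ} (hf : ConvexOn ℝ s f)
    {t σ C : ℝ} (hC : 0 ≤ C) (ht : t ∈ s)
    (h : ∀ x ∈ s, f t + σ * (x - t) - C * (x - t) ^ 2 ≤ f x) :
    ∀ x ∈ s, f t + σ * (x - t) ≤ f x := by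
  intro x hx
  by_contra! hlt
  set e := f t + σ * (x - t) - f x with he
  have he0 : 0 < e := by linarith
  set B := C * (x - t) ^ 2 with hB
  have hB0 : 0 ≤ B := by positivity
  set θ := e / (e + B) with hθ
  have hθ0 : 0 < θ := by positivity
  have hθ1 : θ ≤ 1 := (div_le_one (by positivity)).2 (by linarith)
  have hθe : θ * (e + B) = e := by rw [hθ]; field_simp
  have hconv := hf.2 ht hx (sub_nonneg.2 hθ1) hθ0.le (by ring)
  have hmem := hf.1 ht hx (sub_nonneg.2 hθ1) hθ0.le (by ring)
  have hlow := h _ hmem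
  simp only [smul_eq_mul] at hconv hlow
  have h1 : (1 - θ) * t + θ * x - t = θ * (x - t) := by ring
  rw [h1] at hlow
  have h2 : θ * (e - B * θ) ≤ 0 := by
    rw [he, hB]; nlinarith
  have h3 : e ≤ B * θ := by
    by_contra! h4
    exact absurd h2 (not_le.2 (mul_pos hθ0 (by linarith)))
  nlinarith [mul_pos he0 hθ0]

/-- The gap between a chord and a function with support lines at both ends of the chord. -/
lemma chord_sub_le_of_support {f : ℝ → ℝ} {x z y σ τ : ℝ} (hxz : x < z)
    (hxy : x ≤ y) (hyz : y ≤ z) (hx : f x + σ * (y - x) ≤ f y) (hz : f z + τ * (y - z) ≤ f y)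
    (hστ : σ ≤ τ) :
    f x + (f z - f x) / (z - x) * (y - x) - f y ≤ (τ - σ) * (z - x) / 4 := by
  have hd : 0 < z - x := sub_pos.2 hxz
  have e : f x + (f z - f x) / (z - x) * (y - x) - f y
      = ((z - y) * (f x - f y) + (y - x) * (f z - f y)) / (z - x) := by
    field_simp; ring
  rw [e, div_le_iff₀ hd]
  have h1 := mul_le_mul_of_nonneg_left (show f x - f y ≤ -(σ * (y - x)) by linarith)
    (sub_nonneg.2 hyz)
  have h2 := mul_le_mul_of_nonneg_left (show f z - f y ≤ τ * (z - y) by linarith)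
    (sub_nonneg.2 hxy)
  nlinarith [mul_nonneg (sub_nonneg.2 hστ) (sq_nonneg ((z - y) - (y - x)))]

/-- A convex function with slopes in `[p, q]` on `[a, c]` admits `K` chords whose gap to the
function is at most `(q - p) * (c - a) / (4 * K ^ 2)`. -/
lemma ConvexOn.exists_equidistributed {f : ℝ → ℝ} {a c p q : ℝ} (hac : a < c)
    (hf : ConvexOn ℝ (Set.Icc a c) f) (hcont : ContinuousOn f (Set.Icc a c))
    (hp : ∀ x ∈ Set.Icc a c, f a + p * (x - a) ≤ f x)
    (hq : ∀ x ∈ Set.Icc a c, f c + q * (x - c) ≤ f x) {K : ℕ} (hK : 1 ≤ K) :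
    ∃ t : ℕ → ℝ, t 0 = a ∧ t K = c ∧ (∀ i, t i ∈ Set.Icc a c) ∧
      ∀ i < K, ∀ y, t i ≤ y → y ≤ t (i + 1) →
        f (t i) + (f (t (i + 1)) - f (t i)) / (t (i + 1) - t i) * (y - t i) - f y
          ≤ (q - p) * (c - a) / (4 * K ^ 2) := by
  have hL : 0 < c - a := sub_pos.2 hac
  have hK0 : (0 : ℝ) < K := by exact_mod_cast hK
  have ha : a ∈ Set.Icc a c := ⟨le_rfl, hac.le⟩
  have hc : c ∈ Set.Icc a c := ⟨hac.le, le_rfl⟩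
  have hpq : 0 ≤ q - p := by
    have h1 := hp c hc
    have h2 := hq a ha
    by_contra! h
    nlinarith
  have key : ∀ i : ℕ, ∃ t σ : ℝ, t ∈ Set.Icc a c ∧ (i = 0 → t = a) ∧ (i = K → t = c) ∧
      (c - a) * σ + (q - p) * t = (c - a) * p + (q - p) * a + i * (2 * (q - p) * (c - a) / K) ∧
      ∀ x ∈ Set.Icc a c, f t + σ * (x - t) ≤ f x := by
    intro i
    by_cases hi0 : i = 0
    · refine ⟨a, p, ha, fun _ => rfl, fun h => ?_, by simp [hi0], hp⟩
      omega
    by_cases hiK : i = K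
    · refine ⟨c, q, hc, fun h => absurd h hi0, fun _ => rfl, ?_, hq⟩
      rw [hiK]; field_simp; ring
    set μ := (c - a) * p + (q - p) * a + i * (2 * (q - p) * (c - a) / K) with hμ
    obtain ⟨t, ht, hmin⟩ := isCompact_Icc.exists_isMinOn (s := Set.Icc a c) ⟨a, ha⟩
      (f := fun x => (c - a) * f x + (q - p) * x ^ 2 / 2 - μ * x) (by fun_prop)
    refine ⟨t, (μ - (q - p) * t) / (c - a), ht, fun h => absurd h hi0, fun h => absurd h hiK,
      by field_simp; ring, ?_⟩
    refine hf.support_of_quadratic (C := (q - p) / (2 * (c - a))) (by positivity) ht ?_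
    intro x hx
    have h := hmin hx
    simp only [Set.mem_ofPred_eq] at h
    rw [← mul_le_mul_iff_of_pos_left hL]
    have e : (c - a) * (f t + (μ - (q - p) * t) / (c - a) * (x - t)
        - (q - p) / (2 * (c - a)) * (x - t) ^ 2)
        = (c - a) * f t + (μ - (q - p) * t) * (x - t) - (q - p) / 2 * (x - t) ^ 2 := by
      field_simp
    rw [e]
    nlinarith
  choose t σ ht h0 hKc hσ hsupp using key
  refine ⟨t, h0 0 rfl, hKc K rfl, ht, ?_⟩
  intro i _ y hy1 hy2
  have hM : 0 ≤ (q - p) * (c - a) / (4 * K ^ 2) := by positivity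
  rcases (hy1.trans hy2).eq_or_lt with h | h
  · obtain rfl : y = t i := le_antisymm (h ▸ hy2) hy1
    simpa using hM
  have hymem : y ∈ Set.Icc a c := ⟨(ht i).1.trans hy1, hy2.trans (ht (i + 1)).2⟩
  have hd : 0 < t (i + 1) - t i := sub_pos.2 h
  have hσle : 0 ≤ σ (i + 1) - σ i := by
    have h1 := hsupp i _ (ht (i + 1))
    have h2 := hsupp (i + 1) _ (ht i)
    by_contra! h3
    nlinarith
  refine (chord_sub_le_of_support h hy1 hy2 (hsupp i y hymem) (hsupp (i + 1) y hymem)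
    (sub_nonneg.1 hσle)).trans ?_
  have hsum : (c - a) * (σ (i + 1) - σ i) + (q - p) * (t (i + 1) - t i)
      = 2 * ((q - p) * (c - a) / K) := by
    have h1 := hσ i
    have h2 := hσ (i + 1)
    push_cast at h2
    linear_combination h2 - h1
  suffices hs : (σ (i + 1) - σ i) * (t (i + 1) - t i) ≤ (q - p) * (c - a) / K ^ 2 by
    calc _ ≤ (q - p) * (c - a) / K ^ 2 / 4 := by linarith
      _ = _ := by field_simp
  rcases hpq.eq_or_lt with hpq0 | hpq0
  · rw [← hpq0] at hsum ⊢
    have : σ (i + 1) - σ i = 0 := by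
      simpa [hL.ne'] using hsum
    simp [this]
  · have hprod : ((c - a) * (σ (i + 1) - σ i)) * ((q - p) * (t (i + 1) - t i))
        ≤ ((q - p) * (c - a) / K) ^ 2 := by
      generalize (c - a) * (σ (i + 1) - σ i) = A at hsum ⊢
      generalize (q - p) * (t (i + 1) - t i) = B at hsum ⊢
      rw [show (q - p) * (c - a) / K = (A + B) / 2 by linarith]
      nlinarith [sq_nonneg (A - B)]
    have hpos : 0 < (q - p) * (c - a) := mul_pos hpq0 hL
    rw [← mul_le_mul_iff_of_pos_left hpos]
    calc _ = ((c - a) * (σ (i + 1) - σ i)) * ((q - p) * (t (i + 1) - t i)) := by ring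
      _ ≤ _ := hprod
      _ = _ := by ring

/-- A convex function has a linear interpolation with prescribed nodes, which is bounded by
every chord between the prescribed nodes. -/
lemma ConvexOn.exists_isLinearInterp {f : ℝ → ℝ} {a b : ℝ} (hab : a < b)
    (hf : ConvexOn ℝ (Set.Icc a b) f) {S : Set ℝ} (hS : S ⊆ Set.Icc a b) (hfin : S.Finite)
    (ha : a ∈ S) (hb : b ∈ S) {N : ℕ} (hN : S.ncard ≤ N + 1) :
    ∃ l : ℝ → ℝ, IsLinearInterp f a b N l ∧ ∀ y ∈ Set.Icc a b, f y ≤ l y ∧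
      ∀ p ∈ S, ∀ q ∈ S, p ≤ y → y ≤ q → l y ≤ f p + (f q - f p) / (q - p) * (y - p) := by
  obtain ⟨T, hST, hT, hcard⟩ := (Set.Icc_infinite hab).exists_superset_ncard_eq hS hfin hN
  have hTfin : T.Finite := Set.finite_of_ncard_ne_zero (by omega)
  have hTcard : hTfin.toFinset.card = N + 1 := by rw [← Set.ncard_eq_toFinset_card T hTfin, hcard]
  set t := hTfin.toFinset.orderEmbOfFin hTcard with ht
  have hrange : ∀ p ∈ T, ∃ i, t i = p := by
    intro p hp
    have : p ∈ Set.range t := by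
      rw [ht, Finset.range_orderEmbOfFin]; simpa using hp
    exact this
  have hmem : ∀ i, t i ∈ T := fun i =>
    hTfin.mem_toFinset.1 (Finset.orderEmbOfFin_mem hTfin.toFinset hTcard i)
  have hmono : StrictMono t := t.strictMono
  have ht0 : t 0 = a := by
    obtain ⟨i, hi⟩ := hrange a (hST ha)
    exact le_antisymm (hi ▸ hmono.monotone (Fin.zero_le i)) (hT (hmem 0)).1
  have htl : t (Fin.last N) = b := by
    obtain ⟨i, hi⟩ := hrange b (hST hb)
    exact le_antisymm (hT (hmem _)).2 (hi ▸ hmono.monotone (Fin.le_last i))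
  set ch : Fin N → ℝ → ℝ := fun i y => f (t i.castSucc) +
        (f (t i.succ) - f (t i.castSucc)) / (t i.succ - t i.castSucc) * (y - t i.castSucc) with hch
  have hlt : ∀ i : Fin N, t i.castSucc < t i.succ := fun i => hmono i.castSucc_lt_succ
  have hleft : ∀ i : Fin N, ch i (t i.castSucc) = f (t i.castSucc) := fun i => by simp [hch]
  have hright : ∀ i : Fin N, ch i (t i.succ) = f (t i.succ) := fun i => by
    have := sub_pos.2 (hlt i)
    simp only [hch]; field_simp; ring
  have hcell : ∀ y ∈ Set.Icc a b, ∃ i : Fin N, y ∈ Set.Icc (t i.castSucc) (t i.succ) := by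
    intro y hy
    by_contra! hno
    have : ∀ i : Fin (N + 1), t i ≤ y := by
      intro i
      induction i using Fin.induction with
      | zero => rw [ht0]; exact hy.1
      | succ i ih =>
        by_contra! h
        exact hno i ⟨ih, h.le⟩
    have hyb : y = b := le_antisymm hy.2 (htl ▸ this (Fin.last N))
    rcases Nat.eq_zero_or_pos N with h0 | h0
    · subst h0
      exact hab.ne (ht0.symm.trans htl)
    · obtain ⟨n, rfl⟩ : ∃ n, N = n + 1 := ⟨N - 1, by omega⟩
      refine hno (Fin.last n) ⟨this _, ?_⟩
      rw [Fin.succ_last, htl, hyb]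
  have hagree_lt : ∀ i j : Fin N, i < j → ∀ y, y ∈ Set.Icc (t i.castSucc) (t i.succ) →
      y ∈ Set.Icc (t j.castSucc) (t j.succ) → ch i y = ch j y := by
    intro i j hij y hyi hyj
    have h1 : t i.succ ≤ t j.castSucc := hmono.monotone (by
      rw [Fin.le_def]; simpa using hij)
    have e1 : y = t i.succ := le_antisymm hyi.2 (h1.trans hyj.1)
    have e2 : y = t j.castSucc := le_antisymm (hyi.2.trans h1) hyj.1
    calc ch i y = f y := by rw [e1, hright]
      _ = ch j y := by rw [e2, hleft]
  have hagree : ∀ i j : Fin N, ∀ y, y ∈ Set.Icc (t i.castSucc) (t i.succ) →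
      y ∈ Set.Icc (t j.castSucc) (t j.succ) → ch i y = ch j y := by
    intro i j y hyi hyj
    rcases lt_trichotomy i j with h | h | h
    · exact hagree_lt i j h y hyi hyj
    · rw [h]
    · exact (hagree_lt j i h y hyj hyi).symm
  classical
  set l : ℝ → ℝ := fun y =>
    if h : ∃ i : Fin N, y ∈ Set.Icc (t i.castSucc) (t i.succ) then ch h.choose y else 0 with hl
  have hlch : ∀ i : Fin N, ∀ y ∈ Set.Icc (t i.castSucc) (t i.succ), l y = ch i y := by
    intro i y hy
    have hex : ∃ i : Fin N, y ∈ Set.Icc (t i.castSucc) (t i.succ) := ⟨i, hy⟩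
    simp only [hl, dif_pos hex]
    exact hagree _ _ y hex.choose_spec hy
  refine ⟨l, ⟨t, ht0, htl, hmono, hlch⟩, fun y hy => ?_⟩
  obtain ⟨i, hi⟩ := hcell y hy
  rw [hlch i y hi]
  refine ⟨hf.le_chord (hT (hmem _)) (hT (hmem _)) hi.1 hi.2, ?_⟩
  intro p hp q hq hpy hyq
  have hfy := hf.le_chord (hS hp) (hS hq) hpy hyq
  obtain ⟨j, hj⟩ := hrange p (hST hp)
  obtain ⟨k, hk⟩ := hrange q (hST hq)
  rcases le_or_gt p (t i.castSucc) with hpu | hpu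
  · rcases le_or_gt (t i.succ) q with hvq | hvq
    · have hu := hf.le_chord (hS hp) (hS hq) hpu ((hlt i).le.trans hvq)
      have hv := hf.le_chord (hS hp) (hS hq) (hpu.trans (hlt i).le) hvq
      have hd := sub_pos.2 (hlt i)
      generalize (f q - f p) / (q - p) = m at hu hv ⊢
      have e : ch i y = ((t i.succ - y) * f (t i.castSucc) + (y - t i.castSucc) * f (t i.succ))
          / (t i.succ - t i.castSucc) := by
        simp only [hch]; field_simp; ring
      rw [e, div_le_iff₀ hd]
      nlinarith [mul_le_mul_of_nonneg_left hu (sub_nonneg.2 hi.2),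
        mul_le_mul_of_nonneg_left hv (sub_nonneg.2 hi.1)]
    · have : k ≤ i.castSucc := by
        rw [← hk] at hvq
        have := hmono.lt_iff_lt.1 hvq
        rw [Fin.lt_def] at this
        rw [Fin.le_def]
        simp at this ⊢
        omega
      have h2 : q ≤ t i.castSucc := hk ▸ hmono.monotone this
      have e : y = t i.castSucc := le_antisymm (hyq.trans h2) hi.1
      rw [show ch i y = f y by rw [e, hleft]]
      exact hfy
  · have : i.succ ≤ j := by
      rw [← hj] at hpu
      have := hmono.lt_iff_lt.1 hpu
      rw [Fin.lt_def] at this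
      rw [Fin.le_def]
      simp at this ⊢
      omega
    have h2 : t i.succ ≤ p := hj ▸ hmono.monotone this
    have e : y = t i.succ := le_antisymm hi.2 (h2.trans hpy)
    rw [show ch i y = f y by rw [e, hright]]
    exact hfy

/-- Lower bound for the increments of `Psi`. -/
lemma mul_sub_le_Psi_sub {w : ℝ → ℝ} (hw : MonotoneOn w (Set.Ici 0))
    (hPsi : ∀ x > (0 : ℝ), IntegrableOn (fun t => (w t - w 0) / t) (Set.Ioc 0 x))
    {x y : ℝ} (hx : 0 ≤ x) (hxy : x ≤ y) (hy : 0 < y) :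
    (1 - x / y) * (w x - w 0) ≤ Psi w y - Psi w x := by
  have hint : IntegrableOn (fun t => (w t - w 0) / t) (Set.Ioc x y) :=
    (hPsi y hy).mono_set (Set.Ioc_subset_Ioc_left hx)
  have hintx : IntegrableOn (fun t => (w t - w 0) / t) (Set.Ioc 0 x) :=
    (hPsi y hy).mono_set (Set.Ioc_subset_Ioc_right hxy)
  have hsplit : Psi w y = Psi w x + ∫ t in Set.Ioc x y, (w t - w 0) / t := by
    unfold Psi
    rw [← Set.Ioc_union_Ioc_eq_Ioc hx hxy]
    exact setIntegral_union (Set.Ioc_disjoint_Ioc_of_le le_rfl) measurableSet_Ioc hintx hint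
  have hconst : ∫ _ in Set.Ioc x y, (w x - w 0) / y = (1 - x / y) * (w x - w 0) := by
    rw [setIntegral_const, Real.volume_real_Ioc_of_le hxy, smul_eq_mul]
    field_simp
  have hle : ∫ _ in Set.Ioc x y, (w x - w 0) / y ≤ ∫ t in Set.Ioc x y, (w t - w 0) / t := by
    refine setIntegral_mono_on (by simp) hint measurableSet_Ioc fun t ht => ?_
    have ht0 : 0 < t := hx.trans_lt ht.1
    have h1 : w 0 ≤ w x := hw (Set.mem_Ici.2 le_rfl) hx hx
    have h2 : w x ≤ w t := hw hx ht0.le ht.1.le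
    exact div_le_div₀ (by linarith) (by linarith) ht0 ht.2
  linarith

lemma Psi_le_Psi {w : ℝ → ℝ} (hw : MonotoneOn w (Set.Ici 0))
    (hPsi : ∀ x > (0 : ℝ), IntegrableOn (fun t => (w t - w 0) / t) (Set.Ioc 0 x))
    {x y : ℝ} (hx : 0 ≤ x) (hxy : x ≤ y) : Psi w x ≤ Psi w y := by
  rcases hxy.eq_or_lt with rfl | hlt
  · rfl
  have hy : 0 < y := hx.trans_lt hlt
  have h1 : w 0 ≤ w x := hw (Set.mem_Ici.2 le_rfl) hx hx
  have h2 : 0 ≤ 1 - x / y := sub_nonneg.2 ((div_le_one hy).2 hxy)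
  linarith [mul_sub_le_Psi_sub hw hPsi hx hxy hy, mul_nonneg h2 (sub_nonneg.2 h1)]

/-- The integral of a modulus over `[0, h]` is at most its midpoint approximation. -/
lemma integral_le_midpoint {w : ℝ → ℝ} (hmono : MonotoneOn w (Set.Ici 0))
    (hconc : ConcaveOn ℝ (Set.Ici 0) w) {h : ℝ} (hh : 0 ≤ h) :
    ∫ t in (0 : ℝ)..h, w (h - t) ≤ h * w (h / 2) := by
  have hint : IntervalIntegrable w volume 0 h :=
    MonotoneOn.intervalIntegrable (hmono.mono (by rw [Set.uIcc_of_le hh]; exact fun t ht => ht.1))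
  have hint' : IntervalIntegrable (fun t => w (h - t)) volume 0 h := by
    simpa using (hint.comp_sub_left h).symm
  have e : ∫ t in (0 : ℝ)..h, w (h - t) = ∫ t in (0 : ℝ)..h, w t := by simp
  have hsum : ∫ t in (0 : ℝ)..h, (w t + w (h - t)) ≤ ∫ _ in (0 : ℝ)..h, 2 * w (h / 2) := by
    refine intervalIntegral.integral_mono_on hh (hint.add hint') (by simp) fun t ht => ?_
    have := hconc.2 (show t ∈ Set.Ici 0 from ht.1)
      (show h - t ∈ Set.Ici 0 from sub_nonneg.2 ht.2)
      (by norm_num : (0 : ℝ) ≤ 1 / 2) (by norm_num : (0 : ℝ) ≤ 1 / 2) (by norm_num)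
    simp only [smul_eq_mul] at this
    rw [show 1 / 2 * t + 1 / 2 * (h - t) = h / 2 by ring] at this
    linarith
  rw [intervalIntegral.integral_add hint hint', intervalIntegral.integral_const,
    smul_eq_mul] at hsum
  linarith

/-- First moment of a measure with modulus `w` over an interval. -/
lemma IsModulus.lintegral_sub_le {Q : Measure ℝ} {w : ℝ → ℝ} (hw : IsModulus Q w)
    {x z : ℝ} (hxz : x < z) :
    ∫⁻ y in Set.Ioc x z, ENNReal.ofReal (y - x) ∂Q
      ≤ ENNReal.ofReal ((z - x) * w ((z - x) / 2)) := by
  obtain ⟨hnonneg, hmono, hconc, hmod⟩ := hw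
  set h := z - x with hh
  have hpos : 0 < h := sub_pos.2 hxz
  have hint : IntervalIntegrable w volume 0 h :=
    MonotoneOn.intervalIntegrable
      (hmono.mono (by rw [Set.uIcc_of_le hpos.le]; exact fun t ht => ht.1))
  have hint' : IntervalIntegrable (fun t => w (h - t)) volume 0 h := by
    simpa using (hint.comp_sub_left h).symm
  rw [lintegral_eq_lintegral_meas_lt]
  rotate_left
  · filter_upwards [ae_restrict_mem measurableSet_Ioc] with y hy
    exact sub_nonneg.2 hy.1.le
  · fun_prop
  have hbound : ∀ t ∈ Set.Ioi (0 : ℝ), (Q.restrict (Set.Ioc x z)) {y | t < y - x}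
      ≤ (Set.Ioc 0 h).indicator (fun t => ENNReal.ofReal (w (h - t))) t := by
    intro t ht
    have ht : 0 < t := ht
    have hset : {y | t < y - x} ∩ Set.Ioc x z = Set.Ioc (x + t) z := by
      ext y
      simp only [Set.mem_inter_iff, Set.mem_ofPred_eq, Set.mem_Ioc]
      constructor
      · rintro ⟨h1, h2, h3⟩; exact ⟨by linarith, h3⟩
      · rintro ⟨h1, h2⟩; exact ⟨by linarith, by linarith, h2⟩
    rw [Measure.restrict_apply (measurableSet_lt measurable_const (by fun_prop)), hset]
    by_cases hth : t ≤ h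
    · rw [Set.indicator_of_mem (show t ∈ Set.Ioc 0 h from ⟨ht, hth⟩)]
      have := hmod (Set.Ioc (x + t) z) Set.ordConnected_Ioc (Metric.isBounded_Ioc _ _)
      rw [Real.volume_Ioc, ENNReal.toReal_ofReal (by linarith)] at this
      rwa [show z - (x + t) = h - t by rw [hh]; ring] at this
    · rw [Set.Ioc_eq_empty (by intro h1; linarith)]
      simp
  calc _ ≤ ∫⁻ t in Set.Ioi 0,
        (Set.Ioc 0 h).indicator (fun t => ENNReal.ofReal (w (h - t))) t :=
        setLIntegral_mono' measurableSet_Ioi hbound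
    _ ≤ ∫⁻ t, (Set.Ioc 0 h).indicator (fun t => ENNReal.ofReal (w (h - t))) t :=
        setLIntegral_le_lintegral _ _
    _ = ∫⁻ t in Set.Ioc 0 h, ENNReal.ofReal (w (h - t)) := lintegral_indicator measurableSet_Ioc _
    _ = ENNReal.ofReal (∫ t in Set.Ioc 0 h, w (h - t)) := by
        rw [ofReal_integral_eq_lintegral_ofReal]
        · exact (intervalIntegrable_iff_integrableOn_Ioc_of_le hpos.le).1 hint'
        · filter_upwards [ae_restrict_mem measurableSet_Ioc] with t ht
          exact hnonneg _ (sub_nonneg.2 ht.2)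
    _ ≤ _ := by
        rw [← intervalIntegral.integral_of_le hpos.le]
        exact ENNReal.ofReal_le_ofReal (integral_le_midpoint hmono hconc hpos.le)

/-- Integrated gap between a function and its chord on an interval where the function increases
by at most `v`. -/
lemma IsModulus.lintegral_chord_sub_le {Q : Measure ℝ} {w : ℝ → ℝ} (hw : IsModulus Q w)
    (hPsi : ∀ x > (0 : ℝ), IntegrableOn (fun t => (w t - w 0) / t) (Set.Ioc 0 x))
    {f : ℝ → ℝ} {x z s m v : ℝ} (hxz : x < z) (hs : 0 < s)
    (hsupp : ∀ y ∈ Set.Icc x z, f x + s * (y - x) ≤ f y)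
    (hm : m = (f z - f x) / (z - x)) (hv : f z - f x ≤ v) :
    ∫⁻ y in Set.Ioc x z, ENNReal.ofReal (f x + m * (y - x) - f y) ∂Q
      ≤ ENNReal.ofReal (v * w 0 + v * (Psi w (v / (2 * s)) - Psi w (v / (2 * m)))) := by
  have hd : 0 < z - x := sub_pos.2 hxz
  have hmd : m * (z - x) = f z - f x := by rw [hm]; field_simp
  have hsm : s ≤ m := by
    rw [hm, le_div_iff₀ hd]
    linarith [hsupp z ⟨hxz.le, le_rfl⟩]
  have hm0 : 0 < m := hs.trans_le hsm
  have hv0 : 0 < v := (mul_pos hm0 hd).trans_le (hmd ▸ hv)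
  have h0 : (0 : ℝ) ∈ Set.Ici (0 : ℝ) := Set.mem_Ici.2 le_rfl
  have hX : (0 : ℝ) ≤ v / (2 * m) := by positivity
  have hXh : (z - x) / 2 ≤ v / (2 * m) := by
    rw [div_le_div_iff₀ (by norm_num) (by positivity)]
    nlinarith
  have hPsi' := mul_sub_le_Psi_sub hw.2.1 hPsi hX
    (div_le_div_of_nonneg_left hv0.le (by positivity) (by linarith) :
      v / (2 * m) ≤ v / (2 * s)) (by positivity)
  rw [show v / (2 * m) / (v / (2 * s)) = s / m by field_simp] at hPsi'
  have hratio : 0 ≤ 1 - s / m := sub_nonneg.2 ((div_le_one hm0).2 hsm)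
  have hratio' : 1 - s / m ≤ 1 := by linarith [div_pos hs hm0]
  calc _ ≤ ∫⁻ y in Set.Ioc x z, ENNReal.ofReal (m - s) * ENNReal.ofReal (y - x) ∂Q := by
        refine setLIntegral_mono' measurableSet_Ioc fun y hy => ?_
        rw [← ENNReal.ofReal_mul (sub_nonneg.2 hsm)]
        refine ENNReal.ofReal_le_ofReal ?_
        linarith [hsupp y ⟨hy.1.le, hy.2⟩]
    _ = ENNReal.ofReal (m - s) * ∫⁻ y in Set.Ioc x z, ENNReal.ofReal (y - x) ∂Q :=
        lintegral_const_mul _ (by fun_prop)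
    _ ≤ ENNReal.ofReal (m - s) * ENNReal.ofReal ((z - x) * w ((z - x) / 2)) := by
        gcongr
        exact hw.lintegral_sub_le hxz
    _ = ENNReal.ofReal ((m - s) * ((z - x) * w ((z - x) / 2))) :=
        (ENNReal.ofReal_mul (sub_nonneg.2 hsm)).symm
    _ ≤ _ := by
        refine ENNReal.ofReal_le_ofReal ?_
        have hwX : w ((z - x) / 2) ≤ w (v / (2 * m)) :=
          hw.2.1 (Set.mem_Ici.2 (by positivity)) hX hXh
        have hw0 : 0 ≤ w 0 := hw.1 0 le_rfl
        have hwX0 : 0 ≤ w (v / (2 * m)) := hw.1 _ hX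
        have e : (m - s) * (z - x) = (1 - s / m) * (f z - f x) := by
          rw [← hmd]; field_simp
        calc (m - s) * ((z - x) * w ((z - x) / 2))
            = (1 - s / m) * (f z - f x) * w ((z - x) / 2) := by rw [← e]; ring
          _ ≤ (1 - s / m) * v * w (v / (2 * m)) := by
              refine mul_le_mul (mul_le_mul_of_nonneg_left hv hratio) hwX
                (hw.1 _ (by positivity)) (by positivity)
          _ = v * ((1 - s / m) * w 0) + v * ((1 - s / m) * (w (v / (2 * m)) - w 0)) := by ring
          _ ≤ _ := by
              refine add_le_add (mul_le_mul_of_nonneg_left ?_ hv0.le)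
                (mul_le_mul_of_nonneg_left hPsi' hv0.le)
              nlinarith

/-- Beyond a point where a convex function has a support line of positive slope, nodes at equally
spaced values of the function give chords whose integrated gap is controlled by `Psi`. -/
lemma ConvexOn.exists_equal_increments {Q : Measure ℝ} {w : ℝ → ℝ} (hw : IsModulus Q w)
    (hPsi : ∀ x > (0 : ℝ), IntegrableOn (fun t => (w t - w 0) / t) (Set.Ioc 0 x))
    {f : ℝ → ℝ} {c b δ r V : ℝ} (hcb : c ≤ b) (hf : ConvexOn ℝ (Set.Icc c b) f)
    (hcont : ContinuousOn f (Set.Icc c b)) (hδ : 0 < δ)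
    (hsupp : ∀ x ∈ Set.Icc c b, f c + δ * (x - c) ≤ f x) (hV : f b - f c ≤ V)
    {K : ℕ} (hK : 1 ≤ K) (hr0 : 0 ≤ r)
    (hrb : ∀ y ∈ Set.Ico c b, r * (2 * K * (f b - f y)) ≤ V * (b - y)) :
    ∃ u : ℕ → ℝ, u 0 = c ∧ u K = b ∧ (∀ i, u i ∈ Set.Icc c b) ∧
      ∀ l : ℝ → ℝ, (∀ i < K, ∀ y, u i ≤ y → y ≤ u (i + 1) →
        l y ≤ f (u i) + (f (u (i + 1)) - f (u i)) / (u (i + 1) - u i) * (y - u i)) →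
      ∫⁻ y in Set.Ioc c b, ENNReal.ofReal (l y - f y) ∂Q
        ≤ ENNReal.ofReal (V * w 0 + V / K * (Psi w (V / (2 * K * δ)) - Psi w r)) := by
  have hK0 : (0 : ℝ) < K := by exact_mod_cast hK
  rcases hcb.eq_or_lt with rfl | hcb'
  · exact ⟨fun _ => c, rfl, rfl, fun _ => ⟨le_rfl, le_rfl⟩, fun l _ => by simp⟩
  have hfb : f c < f b := by
    have := hsupp b ⟨hcb, le_rfl⟩
    linarith [mul_pos hδ (sub_pos.2 hcb')]
  have hnode : ∀ i : ℕ, ∃ x ∈ Set.Icc c b, (i = 0 → x = c) ∧ (i = K → x = b) ∧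
      (i ≤ K → f x = f c + i * ((f b - f c) / K)) := by
    intro i
    by_cases hi0 : i = 0
    · exact ⟨c, ⟨le_rfl, hcb⟩, fun _ => rfl, fun h => by omega, fun _ => by simp [hi0]⟩
    by_cases hiK : i = K
    · refine ⟨b, ⟨hcb, le_rfl⟩, fun h => absurd h hi0, fun _ => rfl, fun _ => ?_⟩
      rw [hiK]; field_simp; ring
    rcases lt_or_ge K i with h | h
    · exact ⟨b, ⟨hcb, le_rfl⟩, fun h => absurd h hi0, fun _ => rfl, fun h' => by omega⟩
    have hi : (i : ℝ) ≤ K := by exact_mod_cast h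
    have hmem : f c + i * ((f b - f c) / K) ∈ Set.Icc (f c) (f b) := by
      have hd : 0 < f b - f c := sub_pos.2 hfb
      refine ⟨le_add_of_nonneg_right (by positivity), ?_⟩
      have : (i : ℝ) * ((f b - f c) / K) ≤ K * ((f b - f c) / K) := by gcongr
      rw [mul_div_cancel₀ _ hK0.ne'] at this
      linarith
    obtain ⟨x, hx, hfx⟩ := intermediate_value_Icc hcb hcont hmem
    exact ⟨x, hx, fun h => absurd h hi0, fun h => absurd h hiK, fun _ => hfx⟩
  choose u hu hu0 huK hfu using hnode
  refine ⟨u, hu0 0 rfl, huK K rfl, hu, fun l hl => ?_⟩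
  have hmono : MonotoneOn f (Set.Icc c b) := by
    intro x hx z hz hxz
    rcases (hx.1.trans hxz).eq_or_lt with h | h
    · rw [le_antisymm hxz (h ▸ hx.1)]
    have hchord := hf.le_chord ⟨le_rfl, hcb⟩ hz hx.1 hxz
    have hd : 0 < z - c := sub_pos.2 h
    have hm : 0 ≤ (f z - f c) / (z - c) :=
      div_nonneg (by nlinarith [hsupp z hz]) hd.le
    have : (f z - f c) / (z - c) * (x - c) ≤ (f z - f c) / (z - c) * (z - c) := by gcongr
    rw [div_mul_cancel₀ _ hd.ne'] at this
    linarith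
  have hstep : ∀ i < K, f (u (i + 1)) - f (u i) = (f b - f c) / K := by
    intro i hi
    rw [hfu i hi.le, hfu (i + 1) hi]
    push_cast; ring
  have hult : ∀ i < K, u i < u (i + 1) := by
    intro i hi
    by_contra! h
    have h1 := hmono (hu (i + 1)) (hu i) h
    have h2 := hstep i hi
    have : 0 < (f b - f c) / K := div_pos (sub_pos.2 hfb) hK0
    linarith
  have hind : ∀ n ≤ K, ∃ s, δ ≤ s ∧ (∀ y ∈ Set.Icc (u n) b, f (u n) + s * (y - u n) ≤ f y) ∧
      (0 < n → ∃ x ∈ Set.Ico c (u n), s * (u n - x) = f (u n) - f x) ∧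
      ∫⁻ y in Set.Ioc c (u n), ENNReal.ofReal (l y - f y) ∂Q
        ≤ ENNReal.ofReal (n * (V / K * w 0) +
          V / K * (Psi w (V / K / (2 * δ)) - Psi w (V / K / (2 * s)))) := by
    intro n
    induction n with
    | zero =>
      intro _
      refine ⟨δ, le_rfl, ?_, fun h => absurd h (lt_irrefl _), ?_⟩
      · rw [hu0 0 rfl]; exact hsupp
      · rw [hu0 0 rfl]; simp
    | succ n ih =>
      intro hn
      have hn' : n < K := hn
      obtain ⟨s, hδs, hsu, -, hbound⟩ := ih hn'.le
      have hs : 0 < s := hδ.trans_le hδs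
      have hlt := hult n hn'
      have hd : 0 < u (n + 1) - u n := sub_pos.2 hlt
      set m := (f (u (n + 1)) - f (u n)) / (u (n + 1) - u n) with hm
      have hsm : s ≤ m := by
        rw [hm, le_div_iff₀ hd]
        linarith [hsu _ ⟨hlt.le, (hu (n + 1)).2⟩]
      have hm0 : 0 < m := hs.trans_le hsm
      have hmd : m * (u (n + 1) - u n) = f (u (n + 1)) - f (u n) := by rw [hm]; field_simp
      have hv : f (u (n + 1)) - f (u n) ≤ V / K := by
        rw [hstep n hn']; gcongr
      have hv0 : 0 < V / K := by
        rw [hstep n hn'] at hv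
        exact (div_pos (sub_pos.2 hfb) hK0).trans_le hv
      refine ⟨m, hδs.trans hsm, ?_, fun _ => ⟨u n, ⟨(hu n).1, hlt⟩, hmd⟩, ?_⟩
      · intro y hy
        have hyd : 0 < y - u n := by linarith [hy.1]
        have h := hf.le_chord (hu n) ⟨(hu (n + 1)).1.trans hy.1, hy.2⟩ hlt.le hy.1
        have h2 : m ≤ (f y - f (u n)) / (y - u n) := by
          rw [hm, div_le_iff₀ hd]; linarith
        rw [le_div_iff₀ hyd] at h2
        nlinarith
      · have hcell := hw.lintegral_chord_sub_le hPsi (f := f) hlt hs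
          (fun y hy => hsu y ⟨hy.1, hy.2.trans (hu (n + 1)).2⟩) hm hv
        have hle : ∫⁻ y in Set.Ioc (u n) (u (n + 1)), ENNReal.ofReal (l y - f y) ∂Q
            ≤ ∫⁻ y in Set.Ioc (u n) (u (n + 1)),
                ENNReal.ofReal (f (u n) + m * (y - u n) - f y) ∂Q := by
          refine setLIntegral_mono' measurableSet_Ioc fun y hy => ENNReal.ofReal_le_ofReal ?_
          linarith [hl n hn' y hy.1.le hy.2]
        have hw0 : 0 ≤ w 0 := hw.1 0 le_rfl
        have hsδ : ∀ {σ τ : ℝ}, 0 < σ → σ ≤ τ →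
            Psi w (V / K / (2 * τ)) ≤ Psi w (V / K / (2 * σ)) := by
          intro σ τ hσ hστ
          refine Psi_le_Psi hw.2.1 hPsi (div_nonneg hv0.le (by linarith)) ?_
          exact div_le_div_of_nonneg_left hv0.le (by linarith) (by linarith)
        calc _ ≤ ∫⁻ y in Set.Ioc c (u n), ENNReal.ofReal (l y - f y) ∂Q
              + ∫⁻ y in Set.Ioc (u n) (u (n + 1)), ENNReal.ofReal (l y - f y) ∂Q := by
              rw [← Set.Ioc_union_Ioc_eq_Ioc (hu n).1 hlt.le]
              exact lintegral_union_le _ _ _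
          _ ≤ _ := add_le_add hbound (hle.trans hcell)
          _ = _ := by
              have h1 := sub_nonneg.2 (hsδ hδ hδs)
              have h2 := sub_nonneg.2 (hsδ hs hsm)
              rw [← ENNReal.ofReal_add (by positivity) (by positivity)]
              congr 1
              push_cast; ring
  obtain ⟨s, hδs, -, hs, hbound⟩ := hind K le_rfl
  rw [huK K rfl] at hs hbound
  obtain ⟨x, hx, hsx⟩ := hs hK
  refine hbound.trans (ENNReal.ofReal_le_ofReal ?_)
  have hs0 : 0 < s := hδ.trans_le hδs
  have hV0 : 0 < V := (sub_pos.2 hfb).trans_le hV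
  have hrs : r ≤ V / K / (2 * s) := by
    have h := hrb x hx
    rw [← hsx] at h
    have hd : 0 < b - x := sub_pos.2 hx.2
    rw [div_div, le_div_iff₀ (by positivity)]
    refine le_of_mul_le_mul_right ?_ hd
    linarith
  have hPr := Psi_le_Psi hw.2.1 hPsi hr0 hrs
  rw [show V / (2 * K * δ) = V / K / (2 * δ) by field_simp]
  have e : (K : ℝ) * (V / K * w 0) = V * w 0 := by field_simp
  rw [e]
  have : 0 ≤ V / K := by positivity
  gcongr

/-- The interpolation bound for a convex function which is minimal at the left endpoint. -/
lemma ConvexOn.exists_isLinearInterp_lintegral_le {a b : ℝ} (hab : a < b) {Q : Measure ℝ}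
    [IsProbabilityMeasure Q] {K : ℕ} (hK : 1 ≤ K) {f : ℝ → ℝ}
    (hcont : ContinuousOn f (Set.Icc a b)) (hf : ConvexOn ℝ (Set.Icc a b) f)
    (hmin : ∀ x ∈ Set.Icc a b, f a ≤ f x) {w : ℝ → ℝ} (hw : IsModulus Q w)
    (hPsi : ∀ x > (0 : ℝ), IntegrableOn (fun t => (w t - w 0) / t) (Set.Ioc 0 x))
    {δ p r : ℝ} (hδ : 0 < δ) (hpδ : p ≤ δ)
    (hp : ∀ x ∈ Set.Icc a b, f a + p * (x - a) ≤ f x) (hr0 : 0 ≤ r)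
    (hrδ : r ≤ (f b - f a) / (2 * K * δ))
    (hrb : ∀ y ∈ Set.Ico a b, r * (2 * K * (f b - f y)) ≤ (f b - f a) * (b - y)) :
    ∃ l : ℝ → ℝ, IsLinearInterp f a b (2 * K) l ∧
      ∫⁻ y in Set.Icc a b, ENNReal.ofReal |f y - l y| ∂Q
        ≤ ENNReal.ofReal ((f b - f a) * w 0 + (δ - p) * (b - a) / (4 * K ^ 2)
          + ((f b - f a) / K) * (Psi w ((f b - f a) / (2 * K * δ)) - Psi w r)) := by
  have ha : a ∈ Set.Icc a b := ⟨le_rfl, hab.le⟩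
  have hb : b ∈ Set.Icc a b := ⟨hab.le, le_rfl⟩
  have hba : 0 < b - a := sub_pos.2 hab
  have hδp : 0 ≤ δ - p := sub_nonneg.2 hpδ
  obtain ⟨c, hc, hcmin⟩ := isCompact_Icc.exists_isMinOn (s := Set.Icc a b) ⟨a, ha⟩
    (f := fun x => f x - δ * x) (by fun_prop)
  have hsupp : ∀ x ∈ Set.Icc a b, f c + δ * (x - c) ≤ f x := by
    intro x hx
    have h := hcmin hx
    simp only [Set.mem_ofPred_eq] at h
    linarith
  have hac : Set.Icc a c ⊆ Set.Icc a b := Set.Icc_subset_Icc_right hc.2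
  have hcb : Set.Icc c b ⊆ Set.Icc a b := Set.Icc_subset_Icc_left hc.1
  obtain ⟨t, ht0, htK, ht, htgap⟩ : ∃ t : ℕ → ℝ, t 0 = a ∧ t K = c ∧ (∀ i, t i ∈ Set.Icc a c) ∧
      ∀ i < K, ∀ y, t i ≤ y → y ≤ t (i + 1) →
        f (t i) + (f (t (i + 1)) - f (t i)) / (t (i + 1) - t i) * (y - t i) - f y
          ≤ (δ - p) * (b - a) / (4 * K ^ 2) := by
    rcases hc.1.eq_or_lt with rfl | hlt
    · refine ⟨fun _ => a, rfl, rfl, fun _ => ⟨le_rfl, le_rfl⟩, fun i _ y h1 h2 => ?_⟩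
      obtain rfl : y = a := le_antisymm h2 h1
      simp only [sub_self, mul_zero, add_zero]
      positivity
    · obtain ⟨t, ht0, htK, ht, htgap⟩ := (hf.subset hac (convex_Icc a c)).exists_equidistributed
        hlt (hcont.mono hac) (fun x hx => hp x (hac hx)) (fun x hx => hsupp x (hac hx)) hK
      refine ⟨t, ht0, htK, ht, fun i hi y h1 h2 => (htgap i hi y h1 h2).trans ?_⟩
      gcongr
      exact hc.2
  obtain ⟨u, hu0, huK, hu, hubound⟩ := (hf.subset hcb (convex_Icc c b)).exists_equal_increments
    hw hPsi hc.2 (hcont.mono hcb) hδ (fun x hx => hsupp x (hcb hx))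
    (V := f b - f a) (by linarith [hmin c hc]) hK hr0
    (fun y hy => hrb y ⟨hc.1.trans hy.1, hy.2⟩)
  set S : Finset ℝ := (Finset.range (K + 1)).image t ∪ (Finset.Icc 1 K).image u with hS
  have htS : ∀ i ≤ K, t i ∈ (S : Set ℝ) := fun i hi => Finset.mem_coe.2 <|
    Finset.mem_union_left _ (Finset.mem_image_of_mem t (Finset.mem_range.2 (by omega)))
  have huS : ∀ i ≤ K, u i ∈ (S : Set ℝ) := by
    intro i hi
    rcases Nat.eq_zero_or_pos i with h | h
    · rw [h, hu0, ← htK]; exact htS K le_rfl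
    · exact Finset.mem_coe.2 <| Finset.mem_union_right _
        (Finset.mem_image_of_mem u (Finset.mem_Icc.2 ⟨h, hi⟩))
  have hSsub : (S : Set ℝ) ⊆ Set.Icc a b := by
    intro x hx
    rcases Finset.mem_union.1 (Finset.mem_coe.1 hx) with h | h
    · obtain ⟨i, -, rfl⟩ := Finset.mem_image.1 h
      exact hac (ht i)
    · obtain ⟨i, -, rfl⟩ := Finset.mem_image.1 h
      exact hcb (hu i)
  have hScard : (S : Set ℝ).ncard ≤ 2 * K + 1 := by
    rw [Set.ncard_coe_finset]
    refine (Finset.card_union_le _ _).trans ?_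
    have h1 := Finset.card_image_le (s := Finset.range (K + 1)) (f := t)
    have h2 := Finset.card_image_le (s := Finset.Icc 1 K) (f := u)
    rw [Finset.card_range] at h1
    rw [Nat.card_Icc] at h2
    omega
  obtain ⟨l, hl, hlchord⟩ := hf.exists_isLinearInterp hab hSsub S.finite_toSet
    (ht0 ▸ htS 0 (Nat.zero_le K)) (huK ▸ huS K le_rfl) hScard
  refine ⟨l, hl, ?_⟩
  have hfirst : ∀ y ∈ Set.Icc a c, l y - f y ≤ (δ - p) * (b - a) / (4 * K ^ 2) := by
    intro y hy
    obtain ⟨i, hi, h1, h2⟩ : ∃ i < K, t i ≤ y ∧ y ≤ t (i + 1) := by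
      by_contra! hno
      have : ∀ i ≤ K, t i ≤ y := by
        intro i
        induction i with
        | zero => intro _; rw [ht0]; exact hy.1
        | succ i ih => intro hi; exact (hno i hi (ih (by omega))).le
      obtain ⟨k, rfl⟩ : ∃ k, K = k + 1 := ⟨K - 1, by omega⟩
      have h := hno k (by omega) (this k (by omega))
      rw [htK] at h
      exact absurd hy.2 (not_le.2 h)
    have h3 := (hlchord y (hac hy)).2 _ (htS i hi.le) _ (htS (i + 1) hi) h1 h2
    linarith [htgap i hi y h1 h2]
  have hsecond := hubound l fun i hi y h1 h2 =>
    (hlchord y (hcb ⟨(hu i).1.trans h1, h2.trans (hu (i + 1)).2⟩)).2 _ (huS i hi.le) _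
      (huS (i + 1) hi) h1 h2
  have hV0 : 0 ≤ f b - f a := sub_nonneg.2 (hmin b hb)
  have hw0 : 0 ≤ w 0 := hw.1 0 le_rfl
  have hPr := sub_nonneg.2 (Psi_le_Psi hw.2.1 hPsi hr0 hrδ)
  calc _ = ∫⁻ y in Set.Icc a b, ENNReal.ofReal (l y - f y) ∂Q := by
        refine setLIntegral_congr_fun measurableSet_Icc fun y hy => ?_
        rw [abs_sub_comm, abs_of_nonneg (sub_nonneg.2 (hlchord y hy).1)]
    _ ≤ ∫⁻ y in Set.Icc a c, ENNReal.ofReal (l y - f y) ∂Q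
        + ∫⁻ y in Set.Ioc c b, ENNReal.ofReal (l y - f y) ∂Q := by
        rw [← Set.Icc_union_Ioc_eq_Icc hc.1 hc.2]
        exact lintegral_union_le _ _ _
    _ ≤ ENNReal.ofReal ((δ - p) * (b - a) / (4 * K ^ 2)) + _ := by
        refine add_le_add ?_ hsecond
        calc _ ≤ ∫⁻ _ in Set.Icc a c, ENNReal.ofReal ((δ - p) * (b - a) / (4 * K ^ 2)) ∂Q :=
              setLIntegral_mono' measurableSet_Icc fun y hy =>
                ENNReal.ofReal_le_ofReal (hfirst y hy)
          _ = ENNReal.ofReal ((δ - p) * (b - a) / (4 * K ^ 2)) * Q (Set.Icc a c) :=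
              setLIntegral_const _ _
          _ ≤ _ := mul_le_of_le_one_right zero_le prob_le_one
    _ = _ := by
        rw [← ENNReal.ofReal_add (by positivity) (by positivity)]
        congr 1
        ring

/-- The conclusion of the interpolation theorem, for endpoint slopes with minimum `m` and
maximum `M` in absolute value. -/
def HasInterpBound (a b : ℝ) (Q : Measure ℝ) (K : ℕ) (w : ℝ → ℝ) (δ : ℝ) (m M : ℝ≥0∞)
    (f : ℝ → ℝ) : Prop :=
  ∃ l : ℝ → ℝ, IsLinearInterp f a b (2 * K) l ∧
    ∫⁻ y in Set.Icc a b, ENNReal.ofReal |f y - l y| ∂Q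
      ≤ ENNReal.ofReal (|f b - f a| * w 0 + (δ - m.toReal) * (b - a) / (4 * K ^ 2)
          + (|f b - f a| / K) * (Psi w (|f b - f a| / (2 * K * δ))
              - Psi w ((ENNReal.ofReal |f b - f a| / (2 * K * M)).toReal)))

lemma IsLinearInterp.neg {f l : ℝ → ℝ} {a b : ℝ} {N : ℕ} (h : IsLinearInterp f a b N l) :
    IsLinearInterp (fun x => -f x) a b N (fun x => -l x) := by
  obtain ⟨t, h0, hN, ht, hl⟩ := h
  refine ⟨t, h0, hN, ht, fun i y hy => ?_⟩
  simp only [hl i y hy]; ring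

lemma IsLinearInterp.reflect {f l : ℝ → ℝ} {a b : ℝ} {N : ℕ} (h : IsLinearInterp f a b N l) :
    IsLinearInterp (fun x => f (a + b - x)) a b N (fun x => l (a + b - x)) := by
  obtain ⟨t, h0, hN, ht, hl⟩ := h
  refine ⟨fun i => a + b - t i.rev, by simp [hN], by simp [h0], fun i j hij => ?_,
    fun i y hy => ?_⟩
  · have := ht (Fin.rev_lt_rev.2 hij)
    simp only
    linarith
  · simp only [Fin.rev_castSucc, Fin.rev_succ] at hy ⊢
    have hd : 0 < t i.rev.succ - t i.rev.castSucc :=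
      sub_pos.2 (ht i.rev.castSucc_lt_succ)
    rw [hl i.rev (a + b - y) ⟨by linarith [hy.2], by linarith [hy.1]⟩]
    simp only [sub_sub_cancel]
    rw [show a + b - t i.rev.castSucc - (a + b - t i.rev.succ)
      = t i.rev.succ - t i.rev.castSucc by ring]
    field_simp
    ring

lemma HasInterpBound.neg {a b : ℝ} {Q : Measure ℝ} {K : ℕ} {w : ℝ → ℝ} {δ : ℝ} {m M : ℝ≥0∞}
    {f : ℝ → ℝ} (h : HasInterpBound a b Q K w δ m M f) :
    HasInterpBound a b Q K w δ m M (fun x => -f x) := by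
  obtain ⟨l, hl, hb⟩ := h
  refine ⟨fun x => -l x, hl.neg, ?_⟩
  have e : ∀ x y : ℝ, |-x - -y| = |x - y| := fun x y => by
    rw [← abs_neg]; ring_nf
  simpa only [e] using hb

lemma HasInterpBound.reflect {a b : ℝ} {Q : Measure ℝ} {K : ℕ} {w : ℝ → ℝ} {δ : ℝ}
    {m M : ℝ≥0∞} {f : ℝ → ℝ}
    (h : HasInterpBound a b (Q.map (fun x => a + b - x)) K w δ m M f) :
    HasInterpBound a b Q K w δ m M (fun x => f (a + b - x)) := by
  obtain ⟨l, hl, hb⟩ := h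
  refine ⟨fun x => l (a + b - x), hl.reflect, ?_⟩
  have e : MeasurableEmbedding (fun x : ℝ => a + b - x) :=
    (MeasurableEquiv.subLeft (a + b)).measurableEmbedding
  rw [e.restrict_map, e.lintegral_map] at hb
  have hpre : (fun x : ℝ => a + b - x) ⁻¹' Set.Icc a b = Set.Icc a b := by
    simp
  rw [hpre] at hb
  simpa [abs_sub_comm] using hb

lemma IsModulus.reflect {Q : Measure ℝ} {w : ℝ → ℝ} (h : IsModulus Q w) (c : ℝ) :
    IsModulus (Q.map (fun x => c - x)) w := by
  refine ⟨h.1, h.2.1, h.2.2.1, fun I hI hbdd => ?_⟩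
  have e : MeasurableEmbedding (fun x : ℝ => c - x) :=
    (MeasurableEquiv.subLeft c).measurableEmbedding
  rw [e.map_apply, ← (Measure.measurePreserving_sub_left volume c).measure_preimage
    hI.measurableSet.nullMeasurableSet]
  refine h.2.2.2 _ ⟨fun x hx y hy z hz => hI.out hy hx ⟨?_, ?_⟩⟩ ?_
  · linarith [hz.2]
  · linarith [hz.1]
  · obtain ⟨C, hC⟩ := isBounded_iff_forall_norm_le.1 hbdd
    refine isBounded_iff_forall_norm_le.2 ⟨‖c‖ + C, fun x hx => ?_⟩
    calc ‖x‖ = ‖c - (c - x)‖ := by rw [sub_sub_cancel]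
      _ ≤ ‖c‖ + ‖c - x‖ := norm_sub_le _ _
      _ ≤ _ := by gcongr; exact hC _ hx

lemma EReal.continuous_abs : Continuous EReal.abs := by
  have : EReal.abs = fun x : EReal => (max x (-x)).toENNReal := by
    ext1 x
    induction x with
    | bot => simp
    | top => simp
    | coe x => 
      rw [EReal.abs_def, ← EReal.coe_neg, ← EReal.coe_strictMono.monotone.map_max,
        EReal.toENNReal_of_ne_top (EReal.coe_ne_top _), EReal.toReal_coe, abs, max_def]
  rw [this]
  fun_prop

/-- The interpolation bound for a nondecreasing convex function. -/
lemma hasInterpBound_of_monotoneOn_convexOn {a b : ℝ} (hab : a < b) {Q : Measure ℝ}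
    [IsProbabilityMeasure Q] {K : ℕ} (hK : 1 ≤ K) {f : ℝ → ℝ}
    (hcont : ContinuousOn f (Set.Icc a b)) (hmono : MonotoneOn f (Set.Icc a b))
    (hf : ConvexOn ℝ (Set.Icc a b) f) {w : ℝ → ℝ} (hw : IsModulus Q w)
    (hPsi : ∀ x > (0 : ℝ), IntegrableOn (fun t => (w t - w 0) / t) (Set.Ioc 0 x))
    {A B : ℝ≥0∞}
    (hA : Tendsto (fun y => ENNReal.ofReal |(f y - f a) / (y - a)|)
      (nhdsWithin a (Set.Ioi a)) (nhds A))
    (hB : Tendsto (fun y => ENNReal.ofReal |(f b - f y) / (b - y)|)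
      (nhdsWithin b (Set.Iio b)) (nhds B))
    {δ : ℝ} (hδ : 0 < δ) (hδmin : min A B ≤ ENNReal.ofReal δ)
    (hδmax : ENNReal.ofReal δ ≤ max A B) :
    HasInterpBound a b Q K w δ (min A B) (max A B) f := by
  have ha : a ∈ Set.Icc a b := ⟨le_rfl, hab.le⟩
  have hb : b ∈ Set.Icc a b := ⟨hab.le, le_rfl⟩
  have hK0 : (0 : ℝ) < K := by exact_mod_cast hK
  have hV : 0 ≤ f b - f a := sub_nonneg.2 (hmono ha hb hab.le)
  have hslope : ∀ x ∈ Set.Icc a b, ∀ y ∈ Set.Icc a b, x < y → 0 ≤ (f y - f x) / (y - x) :=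
    fun x hx y hy hxy =>
      div_nonneg (sub_nonneg.2 (hmono hx hy hxy.le)) (sub_pos.2 hxy).le
  have hAle : ∀ x ∈ Set.Ioc a b, A ≤ ENNReal.ofReal ((f x - f a) / (x - a)) := by
    intro x hx
    refine le_of_tendsto hA ?_
    filter_upwards [Ioc_mem_nhdsGT hx.1] with y hy
    have hy' : y ∈ Set.Icc a b := ⟨hy.1.le, hy.2.trans hx.2⟩
    rw [abs_of_nonneg (hslope a ha y hy' hy.1)]
    exact ENNReal.ofReal_le_ofReal
      (hf.secant_mono ha hy' ⟨hx.1.le, hx.2⟩ hy.1.ne' hx.1.ne' hy.2)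
  have hleB : ∀ y ∈ Set.Ico a b, ENNReal.ofReal ((f b - f y) / (b - y)) ≤ B := by
    intro y hy
    refine ge_of_tendsto hB ?_
    filter_upwards [Ico_mem_nhdsLT hy.2] with z hz
    have hz' : z ∈ Set.Icc a b := ⟨hy.1.trans hz.1, hz.2.le⟩
    rw [abs_of_nonneg (hslope z hz' b hb hz.2)]
    refine ENNReal.ofReal_le_ofReal ?_
    have := hf.secant_mono hb ⟨hy.1, hy.2.le⟩ hz' hy.2.ne hz.2.ne hz.1
    rwa [← neg_sub (f b), ← neg_sub b, neg_div_neg_eq, ← neg_sub (f b), ← neg_sub b,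
      neg_div_neg_eq] at this
  have hr : ∀ σ : ℝ, 0 < σ → ENNReal.ofReal σ ≤ max A B →
      (ENNReal.ofReal (f b - f a) / (2 * K * max A B)).toReal
        ≤ (f b - f a) / (2 * K * σ) := by
    intro σ hσ hle
    refine ENNReal.toReal_le_of_le_ofReal (by positivity) ?_
    rw [ENNReal.ofReal_div_of_pos (by positivity), ENNReal.ofReal_mul (by positivity),
      ENNReal.ofReal_mul (by norm_num), ENNReal.ofReal_natCast, ENNReal.ofReal_ofNat]
    gcongr
  unfold HasInterpBound
  rw [abs_of_nonneg hV]
  refine hf.exists_isLinearInterp_lintegral_le hab hK hcont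
    (fun x hx => hmono ha hx hx.1) hw hPsi hδ (ENNReal.toReal_le_of_le_ofReal hδ.le hδmin) ?_
    ENNReal.toReal_nonneg (hr δ hδ hδmax) ?_
  · intro x hx
    rcases hx.1.eq_or_lt with rfl | hlt
    · simp
    have h := ENNReal.toReal_le_of_le_ofReal (hslope a ha x hx hlt)
      ((min_le_left A B).trans (hAle x ⟨hlt, hx.2⟩))
    rw [le_div_iff₀ (sub_pos.2 hlt)] at h
    linarith
  · intro y hy
    have hd : 0 < b - y := sub_pos.2 hy.2
    rcases (hslope y ⟨hy.1, hy.2.le⟩ b hb hy.2).eq_or_lt with h0 | h0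
    · have : f b - f y = 0 := by
        rcases div_eq_zero_iff.1 h0.symm with h | h
        · exact h
        · exact absurd h hd.ne'
      rw [this]
      simpa using mul_nonneg hV hd.le
    · have h := hr _ h0 ((hleB y hy).trans (le_max_right A B))
      rw [le_div_iff₀ (by positivity)] at h
      calc _ = (ENNReal.ofReal (f b - f a) / (2 * K * max A B)).toReal
            * (2 * K * ((f b - f y) / (b - y))) * (b - y) := by field_simp
        _ ≤ _ := by gcongr

/-- The interpolation bound for a nondecreasing convex or nonincreasing concave function. -/
lemma hasInterpBound_of_abs_slope_mono {a b : ℝ} (hab : a < b) {Q : Measure ℝ}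
    [IsProbabilityMeasure Q] {K : ℕ} (hK : 1 ≤ K) {f : ℝ → ℝ}
    (hcont : ContinuousOn f (Set.Icc a b))
    (hf : MonotoneOn f (Set.Icc a b) ∧ ConvexOn ℝ (Set.Icc a b) f ∨
      AntitoneOn f (Set.Icc a b) ∧ ConcaveOn ℝ (Set.Icc a b) f)
    {w : ℝ → ℝ} (hw : IsModulus Q w)
    (hPsi : ∀ x > (0 : ℝ), IntegrableOn (fun t => (w t - w 0) / t) (Set.Ioc 0 x))
    {A B : ℝ≥0∞}
    (hA : Tendsto (fun y => ENNReal.ofReal |(f y - f a) / (y - a)|)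
      (nhdsWithin a (Set.Ioi a)) (nhds A))
    (hB : Tendsto (fun y => ENNReal.ofReal |(f b - f y) / (b - y)|)
      (nhdsWithin b (Set.Iio b)) (nhds B))
    {δ : ℝ} (hδ : 0 < δ) (hδmin : min A B ≤ ENNReal.ofReal δ)
    (hδmax : ENNReal.ofReal δ ≤ max A B) :
    HasInterpBound a b Q K w δ (min A B) (max A B) f := by
  rcases hf with ⟨hm, hc⟩ | ⟨hm, hc⟩
  · exact hasInterpBound_of_monotoneOn_convexOn hab hK hcont hm hc hw hPsi hA hB hδ hδmin hδmax
  · have e : ∀ x y z : ℝ, |(-x - -y) / z| = |(x - y) / z| := fun x y z => by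
      rw [← abs_neg]; ring_nf
    have h := (hasInterpBound_of_monotoneOn_convexOn (f := fun x => -f x) hab hK hcont.neg hm.neg
      hc.neg hw hPsi (by simpa only [e] using hA) (by simpa only [e] using hB)
      hδ hδmin hδmax).neg
    simpa only [neg_neg] using h

/-- Theorem 3(ii): under a modulus assumption on `Q`, for every
`δ ∈ [δ_min, δ_max] ∩ (0,∞)` there exists a `2K`-linear interpolation `fbar` of `f`
on `[a,b]` with
`∫ |f − fbar| dQ ≤ V·w(0) + (δ−δ_min)(b−a)/(4K²) + (V/K)[Ψ(V/(2Kδ)) − Ψ(V/(2K·δ_max))]`. -/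
theorem stmt11 (a b : ℝ) (hab : a < b) (Q : Measure ℝ) [IsProbabilityMeasure Q]
    (hQ : Q (Set.Icc a b)ᶜ = 0) (K : ℕ) (hK : 1 ≤ K) (f : ℝ → ℝ)
    (hcont : ContinuousOn f (Set.Icc a b))
    (hmono : MonotoneOn f (Set.Icc a b) ∨ AntitoneOn f (Set.Icc a b))
    (hcvx : ConvexOn ℝ (Set.Icc a b) f ∨ ConcaveOn ℝ (Set.Icc a b) f)
    (dra dlb : EReal)
    (hdra : Tendsto (fun y => (((f y - f a) / (y - a) : ℝ) : EReal))
      (nhdsWithin a (Set.Ioi a)) (nhds dra))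
    (hdlb : Tendsto (fun y => (((f b - f y) / (b - y) : ℝ) : EReal))
      (nhdsWithin b (Set.Iio b)) (nhds dlb))
    (V : ℝ) (hV : V = |f b - f a|)
    (w : ℝ → ℝ) (hw : IsModulus Q w)
    (hPsiFin : ∀ x > (0 : ℝ), IntegrableOn (fun t => (w t - w 0) / t) (Set.Ioc 0 x))
    (δ : ℝ) (hδpos : 0 < δ)
    (hδmin : min dra.abs dlb.abs ≤ ENNReal.ofReal δ)
    (hδmax : ENNReal.ofReal δ ≤ max dra.abs dlb.abs) :
    ∃ fbar : ℝ → ℝ, IsLinearInterp f a b (2 * K) fbar ∧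
      ∫⁻ y in Set.Icc a b, ENNReal.ofReal |f y - fbar y| ∂Q
        ≤ ENNReal.ofReal (V * w 0
            + (δ - (min dra.abs dlb.abs).toReal) * (b - a) / (4 * K ^ 2)
            + (V / K) * (Psi w (V / (2 * K * δ))
                - Psi w ((ENNReal.ofReal V / (2 * K * max dra.abs dlb.abs)).toReal))) := by
  have hA : Tendsto (fun y => ENNReal.ofReal |(f y - f a) / (y - a)|)
      (nhdsWithin a (Set.Ioi a)) (nhds dra.abs) := by
    simpa only [Function.comp_def, EReal.abs_def] using
      (EReal.continuous_abs.tendsto dra).comp hdra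
  have hB : Tendsto (fun y => ENNReal.ofReal |(f b - f y) / (b - y)|)
      (nhdsWithin b (Set.Iio b)) (nhds dlb.abs) := by
    simpa only [Function.comp_def, EReal.abs_def] using
      (EReal.continuous_abs.tendsto dlb).comp hdlb
  subst hV
  change HasInterpBound a b Q K w δ (min dra.abs dlb.abs) (max dra.abs dlb.abs) f
  by_cases hcase : MonotoneOn f (Set.Icc a b) ∧ ConvexOn ℝ (Set.Icc a b) f ∨
      AntitoneOn f (Set.Icc a b) ∧ ConcaveOn ℝ (Set.Icc a b) f
  · exact hasInterpBound_of_abs_slope_mono hab hK hcont hcase hw hPsiFin hA hB hδpos hδmin hδmax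
  have hcase' : AntitoneOn f (Set.Icc a b) ∧ ConvexOn ℝ (Set.Icc a b) f ∨
      MonotoneOn f (Set.Icc a b) ∧ ConcaveOn ℝ (Set.Icc a b) f := by tauto
  set ρ : ℝ → ℝ := fun x => a + b - x with hρ
  have hρmaps : Set.MapsTo ρ (Set.Icc a b) (Set.Icc a b) := fun x hx =>
    ⟨by simp only [hρ]; linarith [hx.2], by simp only [hρ]; linarith [hx.1]⟩
  have hρanti : AntitoneOn ρ (Set.Icc a b) := fun x _ y _ hxy => by
    simp only [hρ]; linarith
  have hρcont : Continuous ρ := by fun_prop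
  have hρaff : ∀ x y s t : ℝ, s + t = 1 → ρ (s • x + t • y) = s • ρ x + t • ρ y := by
    intro x y s t hst
    simp only [hρ, smul_eq_mul]
    linear_combination (-(a + b)) * hst
  have hρab : Tendsto ρ (nhdsWithin a (Set.Ioi a)) (nhdsWithin b (Set.Iio b)) := by
    refine tendsto_nhdsWithin_iff.2 ⟨?_, ?_⟩
    · have := (hρcont.tendsto a).mono_left (nhdsWithin_le_nhds (s := Set.Ioi a))
      simpa [hρ] using this
    · filter_upwards [self_mem_nhdsWithin] with y hy
      have : a < y := hy
      simp only [hρ, Set.mem_Iio]; linarith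
  have hρba : Tendsto ρ (nhdsWithin b (Set.Iio b)) (nhdsWithin a (Set.Ioi a)) := by
    refine tendsto_nhdsWithin_iff.2 ⟨?_, ?_⟩
    · have := (hρcont.tendsto b).mono_left (nhdsWithin_le_nhds (s := Set.Iio b))
      simpa [hρ] using this
    · filter_upwards [self_mem_nhdsWithin] with y hy
      have : y < b := hy
      simp only [hρ, Set.mem_Ioi]; linarith
  have hρQ : IsProbabilityMeasure (Q.map ρ) :=
    Measure.isProbabilityMeasure_map hρcont.aemeasurable
  have hconv : MonotoneOn (fun x => f (ρ x)) (Set.Icc a b) ∧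
        ConvexOn ℝ (Set.Icc a b) (fun x => f (ρ x)) ∨
      AntitoneOn (fun x => f (ρ x)) (Set.Icc a b) ∧
        ConcaveOn ℝ (Set.Icc a b) (fun x => f (ρ x)) := by
    refine hcase'.imp (fun h => ⟨h.1.comp hρanti hρmaps, convex_Icc a b, ?_⟩)
      (fun h => ⟨fun x hx y hy hxy => h.1 (hρmaps hy) (hρmaps hx) (hρanti hx hy hxy), convex_Icc a b, ?_⟩)
    · intro x hx y hy s t hs ht hst
      simp only [hρaff x y s t hst]
      exact h.2.2 (hρmaps hx) (hρmaps hy) hs ht hst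
    · intro x hx y hy s t hs ht hst
      simp only [hρaff x y s t hst]
      exact h.2.2 (hρmaps hx) (hρmaps hy) hs ht hst
  have hA' : Tendsto (fun y => ENNReal.ofReal |(f (ρ y) - f (ρ a)) / (y - a)|)
      (nhdsWithin a (Set.Ioi a)) (nhds dlb.abs) := by
    refine (hB.comp hρab).congr fun y => ?_
    simp only [Function.comp_apply, hρ, add_sub_cancel_left]
    rw [abs_div, abs_div, abs_sub_comm (f b), show b - (a + b - y) = y - a by ring]
  have hB' : Tendsto (fun y => ENNReal.ofReal |(f (ρ b) - f (ρ y)) / (b - y)|)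
      (nhdsWithin b (Set.Iio b)) (nhds dra.abs) := by
    refine (hA.comp hρba).congr fun y => ?_
    simp only [Function.comp_apply, hρ, add_sub_cancel_right]
    rw [abs_div, abs_div, abs_sub_comm (f a), show a + b - y - a = b - y by ring]
  rw [min_comm] at hδmin ⊢
  rw [max_comm] at hδmax ⊢
  have h := (hasInterpBound_of_abs_slope_mono (Q := Q.map ρ) (f := fun x => f (ρ x)) hab hK
    (hcont.comp hρcont.continuousOn hρmaps) hconv (hw.reflect (a + b)) hPsiFin hA' hB' hδpos
    hδmin hδmax).reflect
  simpa only [hρ, sub_sub_cancel] using h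
end

section
/- Let r,k,K be positive integers, 𝒳 a nontrivial interval of ℝ, ℱ a subset of ℱ_{r,k}, and f̄ ∈ ℱ a function that is a piecewise polynomial of degree at most r−1 based on a partition of 𝒳 into at most K nontrivial intervals. Then f̄ is extremal in ℱ with degree not larger than (r+1)·k + r·(K−1). -/
/-- VC-dimension of `𝒜` is at most `D`. -/
def VCDimLE {Y : Type*} (𝒜 : Set (Set Y)) (D : ℕ) : Prop :=
  ∀ B : Finset Y, D < B.card → ∃ C : Set Y, C ⊆ ↑B ∧ ∀ A ∈ 𝒜, (↑B ∩ A : Set Y) ≠ C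

/-- `gbar` is extremal in `𝒢` with degree at most `D`. -/
def ExtremalDegLE {Y : Type*} (𝒢 : Set (Y → ℝ)) (gbar : Y → ℝ) (D : ℕ) : Prop :=
  VCDimLE {S | ∃ g ∈ 𝒢, S = {y | gbar y < g y}} D ∧
  VCDimLE {S | ∃ g ∈ 𝒢, S = {y | g y < gbar y}} D

/-- `P` is a partition of `𝒳` into nontrivial intervals. -/
def IsIntervalPartition (𝒳 : Set ℝ) (P : Finset (Set ℝ)) : Prop :=
  (∀ J ∈ P, J.OrdConnected ∧ J.Nontrivial ∧ J ⊆ 𝒳) ∧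
  ∀ y ∈ 𝒳, ∃! J, J ∈ P ∧ y ∈ J

/-- The `(r+1)×(r+1)` matrix whose `i`-th row is `(1, vᵢ, vᵢ², …, vᵢ^{r−1}, f(vᵢ))`. -/
noncomputable def Lmat (r : ℕ) (v : Fin (r + 1) → ℝ) (f : ℝ → ℝ) :
    Matrix (Fin (r + 1)) (Fin (r + 1)) ℝ :=
  fun i j => if (j : ℕ) < r then v i ^ (j : ℕ) else f (v i)

/-- `f` is `r`-nondecreasing on `I`. -/
def RNondecreasingOn (r : ℕ) (f : ℝ → ℝ) (I : Set ℝ) : Prop :=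
  ∀ v : Fin (r + 1) → ℝ, (∀ i, v i ∈ I) → StrictMono v → 0 ≤ (Lmat r v f).det

/-- `f` is `r`-monotone on `I`: `r`-nondecreasing or `r`-nonincreasing on `I`. -/
def RMonotoneOn (r : ℕ) (f : ℝ → ℝ) (I : Set ℝ) : Prop :=
  RNondecreasingOn r f I ∨ RNondecreasingOn r (fun y => -f y) I

/-- The class `ℱ_{r,k}` of functions which are `r`-monotone on each element of some
partition of `𝒳` into at most `k` nontrivial intervals. -/
def Frk (𝒳 : Set ℝ) (r k : ℕ) : Set (ℝ → ℝ) :=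
  {f | ∃ P : Finset (Set ℝ), P.card ≤ k ∧ IsIntervalPartition 𝒳 P ∧
    ∀ J ∈ P, RMonotoneOn r f J}

/-- `f` is a piecewise polynomial of degree at most `r − 1` on a partition of `𝒳`
into at most `K` nontrivial intervals. -/
def PiecewisePoly (𝒳 : Set ℝ) (r K : ℕ) (f : ℝ → ℝ) : Prop :=
  ∃ P : Finset (Set ℝ), P.card ≤ K ∧ IsIntervalPartition 𝒳 P ∧
    ∀ J ∈ P, ∃ c : Fin r → ℝ, ∀ y ∈ J, f y = ∑ j, c j * y ^ (j : ℕ)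

open Finset in
/-- Expansion of `L_v(f)` along its last column; the cofactors are Vandermonde determinants. -/
theorem Lmat_det_eq_sum (r : ℕ) (v : Fin (r + 1) → ℝ) (f : ℝ → ℝ) :
    (Lmat r v f).det = ∑ i : Fin (r + 1), (-1) ^ ((i : ℕ) + r) * f (v i) *
      (Matrix.vandermonde fun j => v (i.succAbove j)).det := by
  rw [Matrix.det_succ_column _ (Fin.last r)]
  refine sum_congr rfl fun i _ => ?_
  congr 2
  · simp [Lmat]
  · ext a b
    simp [Lmat, Matrix.vandermonde]

theorem vandermonde_det_pos {n : ℕ} {v : Fin n → ℝ} (hv : StrictMono v) :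
    0 < (Matrix.vandermonde v).det := by
  rw [Matrix.det_vandermonde]
  refine Finset.prod_pos fun i _ => Finset.prod_pos fun j hj => ?_
  exact sub_pos.2 (hv (Finset.mem_Ioi.1 hj))

/-- Polynomials of degree at most `r - 1` are annihilated by `L_v`. -/
theorem Lmat_det_poly (r : ℕ) (v : Fin (r + 1) → ℝ) (c : Fin r → ℝ) :
    (Lmat r v fun y => ∑ j, c j * y ^ (j : ℕ)).det = 0 := by
  have hpow (j : Fin r) : (Lmat r v fun y => y ^ (j : ℕ)).det = 0 := by
    refine Matrix.det_zero_of_column_eq (i := j.castSucc) (j := Fin.last r)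
      (Fin.castSucc_lt_last j).ne fun i => ?_
    simp [Lmat]
  simp only [Lmat_det_eq_sum] at hpow ⊢
  simp_rw [Finset.mul_sum, Finset.sum_mul]
  rw [Finset.sum_comm]
  refine Finset.sum_eq_zero fun j _ => ?_
  rw [← mul_zero (c j), ← hpow j, Finset.mul_sum]
  exact Finset.sum_congr rfl fun i _ => by ring

/-- If `f - p` weakly alternates in sign along `v`, strictly where it is positive, with `p` a
polynomial of degree at most `r - 1`, then `L_v(f)` is nonzero with the corresponding sign. -/
theorem Lmat_det_sign {r : ℕ} (hr : 1 ≤ r) {v : Fin (r + 1) → ℝ} (hv : StrictMono v)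
    {f p : ℝ → ℝ} {c : Fin r → ℝ} (hp : ∀ i, p (v i) = ∑ j, c j * v i ^ (j : ℕ)) {e : ℕ}
    (he : ∀ i : Fin (r + 1), p (v i) < f (v i) ↔ Even (e + i)) :
    0 < (-1) ^ (e + r) * (Lmat r v f).det := by
  have hsum : (-1) ^ (e + r) * (Lmat r v f).det = ∑ i : Fin (r + 1),
      (-1) ^ (e + (i : ℕ)) * (f (v i) - p (v i)) *
        (Matrix.vandermonde fun j => v (i.succAbove j)).det := by
    rw [← sub_zero (Lmat r v f).det, ← Lmat_det_poly r v c, Lmat_det_eq_sum, Lmat_det_eq_sum,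
      ← Finset.sum_sub_distrib, Finset.mul_sum]
    refine Finset.sum_congr rfl fun i _ => ?_
    have h1 : ((-1 : ℝ) ^ r) * (-1) ^ r = 1 := by rw [← mul_pow]; simp
    rw [← hp, pow_add, pow_add, pow_add]
    linear_combination (-1) ^ e * (-1) ^ (i : ℕ) * (f (v i) - p (v i)) *
        (Matrix.vandermonde fun j => v (i.succAbove j)).det * h1
  have hV (i : Fin (r + 1)) : 0 < (Matrix.vandermonde fun j => v (i.succAbove j)).det :=
    vandermonde_det_pos (hv.comp (Fin.strictMono_succAbove i))
  rw [hsum]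
  refine Finset.sum_pos' (fun i _ => mul_nonneg ?_ (hV i).le) ?_
  · by_cases h : Even (e + (i : ℕ))
    · rw [h.neg_one_pow, one_mul]
      exact (sub_pos.2 ((he i).2 h)).le
    · have h2 := not_lt.1 (mt (he i).1 h)
      rw [(Nat.not_even_iff_odd.1 h).neg_one_pow]
      linarith
  · obtain ⟨i, hi⟩ : ∃ i : Fin (r + 1), Even (e + (i : ℕ)) := by
      rcases Nat.even_or_odd e with h | h
      · exact ⟨0, by simpa using h⟩
      · exact ⟨⟨1, by omega⟩, h.add_one⟩
    refine ⟨i, Finset.mem_univ i, mul_pos ?_ (hV i)⟩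
    rw [hi.neg_one_pow, one_mul]
    exact sub_pos.2 ((he i).2 hi)

/-- `i` is the index of a window `x i, …, x (i + r)` inside a single element of `P`. -/
def IsWindow (P : Finset (Set ℝ)) (x : ℕ → ℝ) (r i : ℕ) : Prop :=
  ∃ J ∈ P, x i ∈ J ∧ x (i + r) ∈ J

section Windows

variable {𝒳 : Set ℝ} {P : Finset (Set ℝ)} {x : ℕ → ℝ} {n : ℕ}

theorem IsIntervalPartition.eq_of_mem (hP : IsIntervalPartition 𝒳 P) {J J' : Set ℝ} (hJ : J ∈ P)
    (hJ' : J' ∈ P) {y : ℝ} (hy : y ∈ J) (hy' : y ∈ J') : J = J' :=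
  (hP.2 y ((hP.1 J hJ).2.2 hy)).unique ⟨hJ, hy⟩ ⟨hJ', hy'⟩

open Classical in
/-- A partition into intervals has fewer than `|P|` breaks, and each of them destroys at most `r`
of the windows of `r + 1` consecutive points. -/
theorem card_not_isWindow_le (hP : IsIntervalPartition 𝒳 P) (hx : StrictMonoOn x (Set.Iio n))
    (hx𝒳 : ∀ i < n, x i ∈ 𝒳) (r : ℕ) :
    ((Finset.range (n - r)).filter fun i => ¬ IsWindow P x r i).card ≤ r * (P.card - 1) := by
  rcases Nat.eq_zero_or_pos n with rfl | hn
  · simp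
  have hex (i : ℕ) : ∃ J, i < n → J ∈ P ∧ x i ∈ J := by
    by_cases hi : i < n
    · obtain ⟨J, hJ, -⟩ := hP.2 _ (hx𝒳 i hi)
      exact ⟨J, fun _ => hJ⟩
    · exact ⟨∅, fun h => absurd h hi⟩
  choose J hJ using hex
  have hmid {a b c : ℕ} (hab : a ≤ b) (hbc : b ≤ c) (hc : c < n) (h : J a = J c) : J b = J c := by
    have hb : b < n := hbc.trans_lt hc
    have ha : a < n := hab.trans_lt hb
    refine hP.eq_of_mem (hJ b hb).1 (hJ c hc).1 (hJ b hb).2 ?_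
    exact (hP.1 _ (hJ c hc).1).1.out (h ▸ (hJ a ha).2) (hJ c hc).2
      ⟨hx.monotoneOn ha hb hab, hx.monotoneOn hb hc hbc⟩
  set cuts := (Finset.range (n - 1)).filter fun t => J t ≠ J (t + 1) with hcuts
  have hcard : cuts.card ≤ P.card - 1 := by
    rw [← Finset.card_erase_of_mem (hJ 0 hn).1]
    refine Finset.card_le_card_of_injOn (fun t => J (t + 1)) ?_ ?_
    · intro t ht
      simp only [hcuts, Finset.coe_filter, Finset.mem_range, Set.mem_ofPred_eq] at ht
      refine Finset.mem_coe.2 (Finset.mem_erase.2 ⟨fun h => ht.2 ?_, (hJ _ (by omega)).1⟩)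
      exact hmid (Nat.zero_le t) t.le_succ (by omega) h.symm
    · have key {t t' : ℕ} (ht' : t' ∈ cuts) (htt : t < t') : J (t + 1) ≠ J (t' + 1) := by
        simp only [hcuts, Finset.mem_filter, Finset.mem_range] at ht'
        exact fun h => ht'.2 (hmid htt t'.le_succ (by omega) h)
      intro t ht t' ht' h
      rcases lt_trichotomy t t' with h1 | h1 | h1
      · exact absurd h (key ht' h1)
      · exact h1
      · exact absurd h.symm (key ht h1)
  have hsub : ((Finset.range (n - r)).filter fun i => ¬ IsWindow P x r i) ⊆
      cuts.biUnion fun t => Finset.Icc (t + 1 - r) t := by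
    intro i hi
    simp only [Finset.mem_filter, Finset.mem_range] at hi
    obtain ⟨hin, hi⟩ := hi
    by_contra hno
    simp only [hcuts, Finset.mem_biUnion, Finset.mem_filter, Finset.mem_range, Finset.mem_Icc,
      not_exists, not_and] at hno
    have hconst : ∀ j ≤ r, J (i + j) = J i := by
      intro j
      induction j with
      | zero => simp
      | succ j ih =>
        intro hj
        rw [← ih (by omega)]
        by_contra hne
        exact hno (i + j) ⟨by omega, fun h => hne h.symm⟩ (by omega) (by omega)
    exact hi ⟨J i, (hJ i (by omega)).1, (hJ i (by omega)).2,
      hconst r le_rfl ▸ (hJ (i + r) (by omega)).2⟩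
  calc _ ≤ _ := Finset.card_le_card hsub
    _ ≤ cuts.card * r := Finset.card_biUnion_le_card_mul _ _ _ fun t _ => by
        rw [Nat.card_Icc]; omega
    _ ≤ r * (P.card - 1) := by rw [mul_comm]; exact Nat.mul_le_mul_left r hcard

theorem IsWindow.of_between (hP : IsIntervalPartition 𝒳 P) (hx : StrictMonoOn x (Set.Iio n))
    {r a b i : ℕ} (ha : IsWindow P x r a) (hb : IsWindow P x r b) (hai : a ≤ i) (hib : i ≤ b)
    (hba : b ≤ a + r) (hbn : b + r < n) : IsWindow P x r i := by
  obtain ⟨J, hJ, haJ, haJ'⟩ := ha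
  obtain ⟨J', hJ', hbJ, hbJ'⟩ := hb
  have hmono {s t : ℕ} (hst : s ≤ t) (ht : t < n) : x s ≤ x t :=
    hx.monotoneOn (hst.trans_lt ht) ht hst
  have hbJ1 : x b ∈ J := (hP.1 J hJ).1.out haJ haJ' ⟨hmono (by omega) (by omega),
    hmono hba (by omega)⟩
  obtain rfl := hP.eq_of_mem hJ hJ' hbJ1 hbJ
  exact ⟨J, hJ, (hP.1 J hJ).1.out haJ hbJ' ⟨hmono hai (by omega), hmono (by omega) hbn⟩,
    (hP.1 J hJ).1.out haJ hbJ' ⟨hmono (by omega) (by omega), hmono (by omega) hbn⟩⟩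

open Classical in
/-- A sign pattern alternating on each window of `P`, and such that successive windows carry
opposite alternations. -/
theorem exists_alternating_pattern (hP : IsIntervalPartition 𝒳 P)
    (hx : StrictMonoOn x (Set.Iio n)) (r : ℕ) :
    ∃ s : ℕ → Prop, ∀ a, a + r < n → IsWindow P x r a → ∀ j ≤ r,
      (s (a + j) ↔ Even (Nat.count (IsWindow P x r) a + j)) := by
  refine ⟨fun i => ∃ a, a + r < n ∧ IsWindow P x r a ∧ a ≤ i ∧ i ≤ a + r ∧
    Even (Nat.count (IsWindow P x r) a + (i - a)), fun b hb hbw j hj => ⟨?_, fun h => ?_⟩⟩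
  · have hcount {c d : ℕ} (hc : IsWindow P x r c) (hd : IsWindow P x r d) (hcd : c ≤ d)
        (hdc : d ≤ c + r) (hdn : d + r < n) :
        Nat.count (IsWindow P x r) d = Nat.count (IsWindow P x r) c + (d - c) := by
      obtain ⟨m, rfl⟩ := Nat.exists_eq_add_of_le hcd
      have hm : Nat.count (fun i => IsWindow P x r (c + i)) m = m :=
        Nat.count_iff_forall.2 fun i hi => hc.of_between hP hx hd (by omega) (by omega) hdc hdn
      rw [Nat.count_add, hm, Nat.add_sub_cancel_left]
    rintro ⟨a, ha, haw, haj, hja, h⟩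
    rcases le_total a b with hab | hab
    · rw [hcount haw hbw hab (by omega) hb]
      convert h using 1
      omega
    · rw [hcount hbw haw hab (by omega) ha] at h
      convert h using 1
      omega
  · exact ⟨b, hb, hbw, by omega, by omega, by simpa using h⟩

end Windows

open Classical in
theorem exists_pattern_not_realized {r k K : ℕ} (hr : 1 ≤ r) (hk : 1 ≤ k) {𝒳 : Set ℝ}
    {p : ℝ → ℝ} (hp : PiecewisePoly 𝒳 r K p) {n : ℕ} (hn : (r + 1) * k + r * (K - 1) < n)
    {x : ℕ → ℝ} (hx : StrictMonoOn x (Set.Iio n)) (hx𝒳 : ∀ i < n, x i ∈ 𝒳) :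
    ∃ s : ℕ → Prop, ∀ f ∈ Frk 𝒳 r k, ¬ ∀ i < n, (p (x i) < f (x i) ↔ s i) := by
  obtain ⟨P, hPK, hP, hpP⟩ := hp
  obtain ⟨s, hs⟩ := exists_alternating_pattern hP hx r
  refine ⟨s, ?_⟩
  rintro f ⟨Q, hQk, hQ, hfQ⟩ hf
  have hmono {s t : ℕ} (hst : s ≤ t) (ht : t < n) : x s ≤ x t :=
    hx.monotoneOn (hst.trans_lt ht) ht hst
  have hsign {a : ℕ} (ha : a + r < n) (haw : IsWindow P x r a) :
      0 < (-1) ^ (Nat.count (IsWindow P x r) a + r) *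
        (Lmat r (fun j : Fin (r + 1) => x (a + j)) f).det := by
    obtain ⟨J, hJ, h1, h2⟩ := id haw
    obtain ⟨c, hc⟩ := hpP J hJ
    refine Lmat_det_sign hr (p := p) (c := c) (fun i j hij => ?_) (fun i => hc _ ?_) fun i => ?_
    · exact hx (show a + (i : ℕ) < n by omega) (show a + (j : ℕ) < n by omega)
        (Nat.add_lt_add_left hij a)
    · exact (hP.1 J hJ).1.out h1 h2 ⟨hmono (by omega) (by omega), hmono (by omega) (by omega)⟩
    · rw [hf _ (by omega), hs a ha haw i (by omega)]
  obtain ⟨i, i', hii, hi', hiP, hi'P, J, hJ, hiJ, hiJ'⟩ : ∃ i i', i < i' ∧ i' + r < n ∧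
      IsWindow P x r i ∧ IsWindow P x r i' ∧ ∃ J ∈ Q, x i ∈ J ∧ x (i' + r) ∈ J := by
    set G := (Finset.range (n - r)).filter fun i => IsWindow P x r i ∧ IsWindow Q x r i with hG
    have hGcard : Q.card < G.card := by
      have hb1 := card_not_isWindow_le hP hx hx𝒳 r
      have hb2 := card_not_isWindow_le hQ hx hx𝒳 r
      have hcov : Finset.range (n - r) ⊆ G ∪
          (((Finset.range (n - r)).filter fun i => ¬ IsWindow P x r i) ∪
            ((Finset.range (n - r)).filter fun i => ¬ IsWindow Q x r i)) := by
        intro i hi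
        simp only [hG, Finset.mem_union, Finset.mem_filter, hi, true_and]
        tauto
      have h1 := Finset.card_le_card hcov
      have h2 := Finset.card_union_le G
        (((Finset.range (n - r)).filter fun i => ¬ IsWindow P x r i) ∪
            ((Finset.range (n - r)).filter fun i => ¬ IsWindow Q x r i))
      have h3 := Finset.card_union_le
        ((Finset.range (n - r)).filter fun i => ¬ IsWindow P x r i)
        ((Finset.range (n - r)).filter fun i => ¬ IsWindow Q x r i)
      have h4 : r * (P.card - 1) ≤ r * (K - 1) := Nat.mul_le_mul_left r (by omega)
      have h5 : r * (Q.card - 1) ≤ r * (k - 1) := Nat.mul_le_mul_left r (by omega)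
      obtain ⟨m, rfl⟩ := Nat.exists_eq_add_of_le hk
      have h6 : (r + 1) * (1 + m) = r * m + r + 1 + m := by ring
      rw [Nat.add_sub_cancel_left] at h5
      rw [Finset.card_range] at h1
      omega
    have hex (i : ℕ) : ∃ J, IsWindow Q x r i → J ∈ Q ∧ x i ∈ J ∧ x (i + r) ∈ J := by
      by_cases hi : IsWindow Q x r i
      · obtain ⟨J, hJ⟩ := id hi
        exact ⟨J, fun _ => hJ⟩
      · exact ⟨∅, fun h => absurd h hi⟩
    choose J hJ using hex
    have hGm {i : ℕ} (hi : i ∈ G) : i + r < n ∧ IsWindow P x r i ∧ IsWindow Q x r i := by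
      simp only [hG, Finset.mem_filter, Finset.mem_range] at hi
      exact ⟨by omega, hi.2⟩
    obtain ⟨i, hi, i', hi', hne, hJJ⟩ := Finset.exists_ne_map_eq_of_card_lt_of_maps_to hGcard
      (f := J) fun i hi => (hJ i (hGm hi).2.2).1
    rcases hne.lt_or_gt with h | h
    · exact ⟨i, i', h, (hGm hi').1, (hGm hi).2.1, (hGm hi').2.1, J i, (hJ i (hGm hi).2.2).1,
        (hJ i (hGm hi).2.2).2.1, hJJ ▸ (hJ i' (hGm hi').2.2).2.2⟩
    · exact ⟨i', i, h, (hGm hi).1, (hGm hi').2.1, (hGm hi).2.1, J i, (hJ i (hGm hi).2.2).1,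
        hJJ ▸ (hJ i' (hGm hi').2.2).2.1, (hJ i (hGm hi).2.2).2.2⟩
  have hnext : ∃ b, i < b ∧ IsWindow P x r b := ⟨i', hii, hi'P⟩
  obtain ⟨hib, hbP⟩ := Nat.find_spec hnext
  have hbmin : ∀ t, i < t → t < Nat.find hnext → ¬ IsWindow P x r t :=
    fun t h1 h2 h3 => Nat.find_min hnext h2 ⟨h1, h3⟩
  have hbi' : Nat.find hnext ≤ i' := Nat.find_min' hnext ⟨hii, hi'P⟩
  generalize Nat.find hnext = b at *
  have hcount : Nat.count (IsWindow P x r) b = Nat.count (IsWindow P x r) i + 1 := by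
    obtain ⟨m, rfl⟩ := Nat.exists_eq_add_of_le (Nat.succ_le_of_lt hib)
    have hm : Nat.count (fun t => IsWindow P x r (i.succ + t)) m = 0 :=
      Nat.count_iff_forall_not.2 fun t ht => hbmin _ (by omega) (by omega)
    rw [Nat.count_add, Nat.count_succ, if_pos hiP, hm, add_zero]
  have hmem {a : ℕ} (h1 : i ≤ a) (h2 : a ≤ i') (j : Fin (r + 1)) : x (a + j) ∈ J :=
    (hQ.1 J hJ).1.out hiJ hiJ' ⟨hmono (by omega) (by omega), hmono (by omega) (by omega)⟩
  have hsm {a : ℕ} (h2 : a ≤ i') : StrictMono fun j : Fin (r + 1) => x (a + j) :=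
    fun j j' hjj => hx (show a + (j : ℕ) < n by omega) (show a + (j' : ℕ) < n by omega)
        (Nat.add_lt_add_left hjj a)
  have hs1 := hsign (show i + r < n by omega) hiP
  have hs2 := hsign (show b + r < n by omega) hbP
  rw [hcount, add_right_comm, pow_succ] at hs2
  have hneg (v : Fin (r + 1) → ℝ) :
      (Lmat r v fun y => -f y).det = -(Lmat r v f).det := by
    simp [Lmat_det_eq_sum]
  have hsgn := neg_one_pow_eq_or ℝ (Nat.count (IsWindow P x r) i + r)
  rcases hfQ J hJ with h | h
  · have g1 := h _ (hmem le_rfl hii.le) (hsm hii.le)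
    have g2 := h _ (hmem hib.le hbi') (hsm hbi')
    rcases hsgn with h0 | h0 <;> rw [h0] at hs1 hs2 <;> linarith
  · have g1 := h _ (hmem le_rfl hii.le) (hsm hii.le)
    have g2 := h _ (hmem hib.le hbi') (hsm hbi')
    rw [hneg] at g1 g2
    rcases hsgn with h0 | h0 <;> rw [h0] at hs1 hs2 <;> linarith

theorem neg_mem_Frk {𝒳 : Set ℝ} {r k : ℕ} {f : ℝ → ℝ} (hf : f ∈ Frk 𝒳 r k) :
    (fun y => -f y) ∈ Frk 𝒳 r k := by
  obtain ⟨P, hPk, hP, h⟩ := hf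
  refine ⟨P, hPk, hP, fun J hJ => ?_⟩
  rcases h J hJ with h | h
  · exact Or.inr (by simpa using h)
  · exact Or.inl h

theorem PiecewisePoly.neg {𝒳 : Set ℝ} {r K : ℕ} {p : ℝ → ℝ} (hp : PiecewisePoly 𝒳 r K p) :
    PiecewisePoly 𝒳 r K fun y => -p y := by
  obtain ⟨P, hPK, hP, h⟩ := hp
  refine ⟨P, hPK, hP, fun J hJ => ?_⟩
  obtain ⟨c, hc⟩ := h J hJ
  exact ⟨fun j => -c j, fun y hy => by simp [hc y hy]⟩

/-- A class of subsets of `𝒳` has VC-dimension at most `D` as soon as, along every increasing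
sequence of more than `D` points, some pattern is not realized. -/
theorem vcDimLE_of_exists_pattern {𝒳 : Set ℝ} {𝒜 : Set (Set 𝒳)} {D : ℕ}
    (h : ∀ n, D < n → ∀ x : ℕ → ℝ, StrictMonoOn x (Set.Iio n) → (∀ i < n, x i ∈ 𝒳) →
      ∃ s : ℕ → Prop, ∀ A ∈ 𝒜, ¬ ∀ i < n, ((∃ y ∈ A, y.val = x i) ↔ s i)) :
    VCDimLE 𝒜 D := by
  intro B hB
  let e := B.orderEmbOfFin rfl
  let x : ℕ → ℝ := fun i => if hi : i < B.card then (e ⟨i, hi⟩ : ℝ) else 0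
  have hxe (i : Fin B.card) : x i = e i := by simp [x]
  have hx : StrictMonoOn x (Set.Iio B.card) := by
    intro i hi j hj hij
    rw [hxe ⟨i, hi⟩, hxe ⟨j, hj⟩]
    exact e.strictMono hij
  obtain ⟨s, hs⟩ := h _ hB x hx fun i hi => by rw [hxe ⟨i, hi⟩]; exact (e ⟨i, hi⟩).2
  refine ⟨{y | ∃ i : Fin B.card, e i = y ∧ s i}, ?_, fun A hA hBA => hs A hA fun i hi => ?_⟩
  · rintro _ ⟨i, rfl, -⟩
    exact B.orderEmbOfFin_mem rfl i
  · have hiff := Set.ext_iff.1 hBA (e ⟨i, hi⟩)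
    have hB' : e ⟨i, hi⟩ ∈ B := B.orderEmbOfFin_mem rfl _
    rw [hxe ⟨i, hi⟩]
    simpa [hB'] using hiff

/-- Theorem 2: if `ℱ ⊆ ℱ_{r,k}` and `fbar ∈ ℱ` is a piecewise
polynomial of degree at most `r−1` on a partition of the nontrivial interval `𝒳` into
at most `K` nontrivial intervals, then `fbar` is extremal in `ℱ` with degree not larger
than `(r+1)k + r(K−1)`. -/
theorem stmt16 (r k K : ℕ) (hr : 1 ≤ r) (hk : 1 ≤ k) (hK : 1 ≤ K)
    (𝒳 : Set ℝ) (h𝒳 : 𝒳.OrdConnected) (h𝒳nt : 𝒳.Nontrivial)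
    (ℱ : Set (ℝ → ℝ)) (hℱ : ℱ ⊆ Frk 𝒳 r k)
    (fbar : ℝ → ℝ) (hmem : fbar ∈ ℱ) (hpoly : PiecewisePoly 𝒳 r K fbar) :
    ExtremalDegLE {g : ↥𝒳 → ℝ | ∃ f ∈ ℱ, g = fun y => f y.val}
      (fun y => fbar y.val) ((r + 1) * k + r * (K - 1)) := by
  constructor
  · refine vcDimLE_of_exists_pattern fun n hn x hx hx𝒳 => ?_
    obtain ⟨s, hs⟩ := exists_pattern_not_realized hr hk hpoly hn hx hx𝒳
    refine ⟨s, ?_⟩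
    rintro _ ⟨_, ⟨f, hf, rfl⟩, rfl⟩ h
    refine hs f (hℱ hf) fun i hi => ?_
    simpa [hx𝒳 i hi] using h i hi
  · refine vcDimLE_of_exists_pattern fun n hn x hx hx𝒳 => ?_
    obtain ⟨s, hs⟩ := exists_pattern_not_realized hr hk hpoly.neg hn hx hx𝒳
    refine ⟨s, ?_⟩
    rintro _ ⟨_, ⟨f, hf, rfl⟩, rfl⟩ h
    refine hs _ (neg_mem_Frk (hℱ hf)) fun i hi => ?_
    simpa [hx𝒳 i hi] using h i hi
end

section
/- Let μ be a Borel measure on ℝ with modulus w, and let f be a nonnegative concave function on [a,b] bounded by B > 0. Then ∫_{[a,b]} f dμ ≤ B·w( (1/B)·∫_a^b f(x) dx ). -/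
open MeasureTheory

/-- A nondecreasing concave function on `[0,∞)` has a supporting line of nonnegative slope at
every point of `(0,∞)`. -/
theorem ConcaveOn.exists_nonneg_slope_le {w : ℝ → ℝ} (hw : ConcaveOn ℝ (Set.Ici 0) w)
    (hmono : MonotoneOn w (Set.Ici 0)) {m : ℝ} (hm : 0 < m) :
    ∃ c, 0 ≤ c ∧ ∀ x, 0 ≤ x → w x ≤ w m + c * (x - m) := by
  set S : Set ℝ := (fun y => (w y - w m) / (y - m)) '' Set.Ioi m with hS
  have key : ∀ x, 0 ≤ x → x < m → ∀ s ∈ S, s ≤ (w m - w x) / (m - x) := by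
    rintro x hx hxm _ ⟨y, hy, rfl⟩
    exact hw.slope_anti_adjacent (Set.mem_Ici.2 hx)
      (Set.mem_Ici.2 (hm.le.trans (le_of_lt hy))) hxm hy
  have hne : S.Nonempty := ⟨_, m + 1, by simp, rfl⟩
  have hbdd : BddAbove S := ⟨_, key 0 le_rfl hm⟩
  refine ⟨sSup S, ?_, fun x hx => ?_⟩
  · refine le_trans ?_ (le_csSup hbdd ⟨m + 1, by simp, rfl⟩)
    have := hmono (Set.mem_Ici.2 hm.le) (Set.mem_Ici.2 (by linarith : 0 ≤ m + 1)) (by linarith)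
    exact div_nonneg (by linarith) (by linarith)
  · rcases lt_trichotomy x m with h | rfl | h
    · have h1 := csSup_le hne (key x hx h)
      rw [le_div_iff₀ (by linarith)] at h1
      linarith
    · simp
    · have h1 := le_csSup hbdd ⟨x, h, rfl⟩
      rw [div_le_iff₀ (by linarith)] at h1
      linarith

/-- Extending a nonnegative concave function on `[a,b]` by zero, the strict superlevel sets at
nonnegative heights are intervals. -/
theorem ConcaveOn.ordConnected_lt_indicator {f : ℝ → ℝ} {a b : ℝ}
    (hf : ConcaveOn ℝ (Set.Icc a b) f) {t : ℝ} (ht : 0 ≤ t) :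
    {x | t < (Set.Icc a b).indicator f x}.OrdConnected := by
  have h : {x | t < (Set.Icc a b).indicator f x} = {x ∈ Set.Icc a b | t < f x} := by
    ext x
    by_cases hx : x ∈ Set.Icc a b
    · simp only [Set.mem_ofPred_eq, Set.indicator_of_mem hx, hx, true_and]
    · simp only [Set.mem_ofPred_eq, Set.indicator_of_notMem hx, hx, false_and, not_lt.2 ht]
  rw [h]
  exact (hf.convex_gt t).ordConnected

/-- A nonnegative concave function on `[a,b]`, extended by zero, is Borel measurable. -/
theorem ConcaveOn.measurable_indicator_Icc {f : ℝ → ℝ} {a b : ℝ}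
    (hf : ConcaveOn ℝ (Set.Icc a b) f) (hpos : ∀ y ∈ Set.Icc a b, 0 ≤ f y) :
    Measurable ((Set.Icc a b).indicator f) := by
  refine measurable_of_Ioi fun t => ?_
  rcases le_or_gt 0 t with ht | ht
  · exact (hf.ordConnected_lt_indicator ht).measurableSet
  · convert MeasurableSet.univ
    exact Set.eq_univ_of_forall fun x => lt_of_lt_of_le ht (Set.indicator_nonneg hpos x)

/-- If `μ` has modulus `w` and `f` is a nonnegative concave function on `[a,b]` bounded by
`B > 0`, then every affine function `u ↦ d + c * u` dominating `w` at the measures of the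
superlevel sets of `f` gives the bound `∫ f dμ ≤ B * d + c * ∫ f dx`. -/
theorem IsModulus.lintegral_le_affine {μ : Measure ℝ} {w : ℝ → ℝ} (hw : IsModulus μ w)
    {a b : ℝ} {f : ℝ → ℝ} {B : ℝ} (hB : 0 < B) (hconc : ConcaveOn ℝ (Set.Icc a b) f)
    (hpos : ∀ y ∈ Set.Icc a b, 0 ≤ f y) (hbd : ∀ y ∈ Set.Icc a b, f y ≤ B)
    {c d : ℝ} (hc : 0 ≤ c) (hd : 0 ≤ d)
    (haff : ∀ t, 0 < t → w (volume {x | t < (Set.Icc a b).indicator f x}).toReal ≤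
      d + c * (volume {x | t < (Set.Icc a b).indicator f x}).toReal) :
    ∫⁻ y, ENNReal.ofReal ((Set.Icc a b).indicator f y) ∂μ ≤
      ENNReal.ofReal d * ENNReal.ofReal B +
        ENNReal.ofReal c * ∫⁻ y, ENNReal.ofReal ((Set.Icc a b).indicator f y) := by
  set g := (Set.Icc a b).indicator f with hg
  have hgm : Measurable g := hconc.measurable_indicator_Icc hpos
  have hg0 : ∀ x, 0 ≤ g x := fun x => Set.indicator_nonneg hpos x
  have hgB : ∀ x, g x ≤ B := fun x => Set.indicator_le' hbd (fun _ _ => hB.le) x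
  have hsub : ∀ t, 0 ≤ t → {x | t < g x} ⊆ Set.Icc a b := fun t ht x hx => by
    by_contra hxn
    have hx' : t < g x := hx
    rw [hg, Set.indicator_of_notMem hxn] at hx'
    linarith
  rw [lintegral_eq_lintegral_meas_lt μ (.of_forall hg0) hgm.aemeasurable,
    lintegral_eq_lintegral_meas_lt volume (.of_forall hg0) hgm.aemeasurable]
  have hanti : Measurable fun t : ℝ => volume {x | t < g x} :=
    Antitone.measurable fun s t hst => measure_mono fun x hx => lt_of_le_of_lt hst hx
  calc ∫⁻ t in Set.Ioi 0, μ {x | t < g x}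
      ≤ ∫⁻ t in Set.Ioi 0, ((Set.Ioo 0 B).indicator (fun _ => ENNReal.ofReal d) t +
          ENNReal.ofReal c * volume {x | t < g x}) := by
        refine setLIntegral_mono' measurableSet_Ioi fun t ht => ?_
        have ht : 0 < t := ht
        rcases lt_or_ge t B with htB | htB
        · rw [Set.indicator_of_mem (Set.mem_Ioo.2 ⟨ht, htB⟩)]
          have hfin : volume {x | t < g x} ≠ ⊤ :=
            ((measure_mono (hsub t ht.le)).trans_lt measure_Icc_lt_top).ne
          refine (hw.2.2.2 _ (hconc.ordConnected_lt_indicator ht.le)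
            ((Metric.isBounded_Icc a b).subset (hsub t ht.le))).trans ?_
          refine (ENNReal.ofReal_le_ofReal (haff t ht)).trans ?_
          rw [ENNReal.ofReal_add hd (by positivity), ENNReal.ofReal_mul hc,
            ENNReal.ofReal_toReal hfin]
        · have : {x | t < g x} = ∅ :=
            Set.eq_empty_of_forall_notMem fun x hx => absurd hx (not_lt.2 ((hgB x).trans htB))
          simp [this]
    _ ≤ _ := by
        rw [lintegral_add_left (measurable_const.indicator measurableSet_Ioo),
          lintegral_const_mul _ hanti]
        gcongr
        refine (setLIntegral_le_lintegral _ _).trans ?_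
        rw [lintegral_indicator_const measurableSet_Ioo]
        simp

/-- Lemma 5: if `μ` has modulus `w` and `f` is a nonnegative concave
function on `[a,b]` bounded by `B > 0`, then `∫_{[a,b]} f dμ ≤ B·w(B⁻¹·∫_a^b f(x) dx)`. -/
theorem stmt19 (μ : Measure ℝ) (w : ℝ → ℝ) (hw : IsModulus μ w)
    (a b : ℝ) (hab : a ≤ b) (f : ℝ → ℝ) (B : ℝ) (hB : 0 < B)
    (hconc : ConcaveOn ℝ (Set.Icc a b) f)
    (hpos : ∀ y ∈ Set.Icc a b, 0 ≤ f y) (hbd : ∀ y ∈ Set.Icc a b, f y ≤ B) :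
    ∫⁻ y in Set.Icc a b, ENNReal.ofReal (f y) ∂μ
      ≤ ENNReal.ofReal (B * w ((1 / B) * ∫ y in a..b, f y)) := by
  have hind : ∀ y, ENNReal.ofReal ((Set.Icc a b).indicator f y) =
      (Set.Icc a b).indicator (fun y => ENNReal.ofReal (f y)) y := fun y => by
    by_cases hy : y ∈ Set.Icc a b
    · rw [Set.indicator_of_mem hy, Set.indicator_of_mem hy]
    · rw [Set.indicator_of_notMem hy, Set.indicator_of_notMem hy, ENNReal.ofReal_zero]
  have hleft : ∫⁻ y in Set.Icc a b, ENNReal.ofReal (f y) ∂μ =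
      ∫⁻ y, ENNReal.ofReal ((Set.Icc a b).indicator f y) ∂μ := by
    simp_rw [hind, lintegral_indicator measurableSet_Icc]
  have hgm := hconc.measurable_indicator_Icc hpos
  have hg0 : ∀ x, 0 ≤ (Set.Icc a b).indicator f x := fun x => Set.indicator_nonneg hpos x
  have hgint : Integrable ((Set.Icc a b).indicator f) := by
    refine Integrable.mono' (g := (Set.Icc a b).indicator fun _ => B)
      ((integrable_indicator_iff measurableSet_Icc).2 (integrableOn_const (by simp)))
      hgm.aestronglyMeasurable (.of_forall fun x => ?_)
    rw [Real.norm_of_nonneg (hg0 x)]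
    exact Set.indicator_le_indicator' (hbd x)
  have hint : ∫ y in a..b, f y = ∫ y, (Set.Icc a b).indicator f y := by
    rw [intervalIntegral.integral_of_le hab, ← integral_Icc_eq_integral_Ioc,
      integral_indicator measurableSet_Icc]
  have hvol : ∫⁻ y, ENNReal.ofReal ((Set.Icc a b).indicator f y) =
      ENNReal.ofReal (∫ y in a..b, f y) := by
    rw [hint, ofReal_integral_eq_lintegral_ofReal hgint (.of_forall hg0)]
  have hI : 0 ≤ ∫ y in a..b, f y := hint ▸ integral_nonneg hg0
  rw [hleft]
  rcases hI.eq_or_lt with h0 | hlt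
  · have hae := (integral_eq_zero_iff_of_nonneg hg0 hgint).1 (hint ▸ h0.symm)
    have hnull : ∀ t, 0 < t → volume {x | t < (Set.Icc a b).indicator f x} = 0 := fun t ht =>
      measure_mono_null (fun x (hx : t < _) => (ht.trans hx).ne') (ae_iff.1 hae)
    refine (hw.lintegral_le_affine hB hconc hpos hbd le_rfl (hw.1 0 le_rfl)
      fun t ht => by simp [hnull t ht]).trans ?_
    rw [← h0, ENNReal.ofReal_mul hB.le]
    simp [mul_comm]
  · set m := (1 / B) * ∫ y in a..b, f y with hm
    have hm0 : 0 < m := by positivity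
    obtain ⟨c, hc, hsupp⟩ := hw.2.2.1.exists_nonneg_slope_le hw.2.1 hm0
    have hd : 0 ≤ w m - c * m := by linarith [hsupp 0 le_rfl, hw.1 0 le_rfl]
    refine (hw.lintegral_le_affine hB hconc hpos hbd hc hd fun t _ => ?_).trans ?_
    · linarith [hsupp _ (ENNReal.toReal_nonneg
        (a := volume {x | t < (Set.Icc a b).indicator f x}))]
    · rw [hvol, ← ENNReal.ofReal_mul hd, ← ENNReal.ofReal_mul hc,
        ← ENNReal.ofReal_add (by positivity) (by positivity)]
      refine ENNReal.ofReal_le_ofReal (le_of_eq ?_)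
      have hBm : ∫ y in a..b, f y = B * m := by rw [hm]; field_simp
      rw [hBm]
      ring
end
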